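/- arXiv:2306.02364 — 3 statements merged into one kernel-verified Lean document; each statement's English description precedes it below -/
import Mathlib

section
/- For all integers d, ℓ ≥ 0 there exists n such that for every tournament G and every law L in G of order at most ℓ, if χ_L(G) > n then there exist A ∈ L and two subsets P, Q ⊆ V(G)∖A with Q ⇒ A and A ⇒ P, such that χ(P) ≥ d and χ(Q) ≥ d. -/
structure Tournament where
  V : Type
  fintype : Fintype V
  adj : V → V → Prop
  asymm : ∀ u v, adj u v → ¬ adj v u
  total : ∀ u v, u ≠ v → adj u v ∨ adj v u

attribute [instance] Tournament.fintype

namespace Tournament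

/-- A set of vertices is transitive if it includes no cyclic triangle. -/
def IsTransitiveSet (T : Tournament) (A : Set T.V) : Prop :=
  ∀ a ∈ A, ∀ b ∈ A, ∀ c ∈ A, T.adj a b → T.adj b c → ¬ T.adj c a

/-- The chromatic number of the subtournament induced on `A`. -/
noncomputable def chiOn (T : Tournament) (A : Set T.V) : ℕ :=
  sInf {k | ∃ C : Fin k → Set T.V, (∀ i, T.IsTransitiveSet (C i)) ∧ A ⊆ ⋃ i, C i}

noncomputable def chi (T : Tournament) : ℕ := T.chiOn Set.univ

def outN (T : Tournament) (v : T.V) : Set T.V := {u | T.adj v u}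
def inN (T : Tournament) (v : T.V) : Set T.V := {u | T.adj u v}

/-- The domination number of the subtournament induced on `A`. -/
noncomputable def domOn (T : Tournament) (A : Set T.V) : ℕ :=
  sInf {n | ∃ X : Finset T.V, ↑X ⊆ A ∧ (∀ v ∈ A, v ∉ X → ∃ x ∈ X, T.adj x v) ∧ X.card = n}

noncomputable def dom (T : Tournament) : ℕ := T.domOn Set.univ

/-- `A ⇒ B`: every edge between `A` and `B` is directed from `A` to `B`. -/
def CompleteTo (T : Tournament) (A B : Set T.V) : Prop :=
  ∀ a ∈ A, ∀ b ∈ B, T.adj a b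

def CompletePair (T : Tournament) (A B : Set T.V) : Prop :=
  Disjoint A B ∧ T.CompleteTo A B

/-- `G` has a subtournament inside `A` isomorphic to `H`. -/
def ContainsOn (G : Tournament) (A : Set G.V) (H : Tournament) : Prop :=
  ∃ f : H.V → G.V, Function.Injective f ∧ (∀ u, f u ∈ A) ∧
    ∀ u v, H.adj u v ↔ G.adj (f u) (f v)

def Contains (G H : Tournament) : Prop := G.ContainsOn Set.univ H

def IsHero (H : Tournament) : Prop :=
  ∃ c > 0, ∀ G : Tournament, ¬ G.Contains H → G.chi < c

def IsRebel (H : Tournament) : Prop :=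
  ∃ c > 0, ∀ G : Tournament, ¬ G.Contains H → G.dom < c

/-- A law for `G`: a set of subsets of `V(G)`, each including the vertex set of
a cyclic triangle of `G`. -/
def IsLaw (G : Tournament) (L : Set (Set G.V)) : Prop :=
  ∀ A ∈ L, ∃ x ∈ A, ∃ y ∈ A, ∃ z ∈ A, G.adj x y ∧ G.adj y z ∧ G.adj z x

/-- The `L`-chromatic number: the minimum `k` such that `V(G)` can be covered by
`k` sets, each including no member of `L`. -/
noncomputable def chiLaw (G : Tournament) (L : Set (Set G.V)) : ℕ :=
  sInf {k | ∃ C : Fin k → Set G.V, (∀ i, ∀ A ∈ L, ¬ A ⊆ C i) ∧ ∀ v, ∃ i, v ∈ C i}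

end Tournament

namespace LawAux

open Tournament Classical

/-- `Y` is covered by at most `n` sets with property `p`. -/
def Cov {α : Type} (p : Set α → Prop) (n : ℕ) (Y : Set α) : Prop :=
  ∃ C : Finset (Set α), C.card ≤ n ∧ (∀ c ∈ C, p c) ∧ ∀ y ∈ Y, ∃ c ∈ C, y ∈ c

def Free {α : Type} (L : Set (Set α)) (F : Set α) : Prop := ∀ A ∈ L, ¬ A ⊆ F

/-- chromatic number at least `k` -/
def Big (G : Tournament) (k : ℕ) (Y : Set G.V) : Prop :=
  ∀ C : Finset (Set G.V), (∀ c ∈ C, G.IsTransitiveSet c) → (∀ y ∈ Y, ∃ c ∈ C, y ∈ c) → k ≤ C.card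

def NP (G : Tournament) (A : Set G.V) : Set G.V := {v | ∀ a ∈ A, G.adj a v}

def Tr (G : Tournament) (L : Set (Set G.V)) (k : ℕ) (X : Set G.V) : Prop :=
  ∀ F, Free L F → Big G k (X \ F)

def Domi (G : Tournament) (D : Finset G.V) (Y : Set G.V) : Prop :=
  ∀ y ∈ Y, y ∈ D ∨ ∃ x ∈ D, G.adj x y

variable {α : Type} {p q : Set α → Prop}

lemma Cov.mono {m n : ℕ} {Y Z : Set α} (h : Cov p m Y) (hmn : m ≤ n) (hZ : Z ⊆ Y) :
    Cov p n Z := by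
  obtain ⟨C, h1, h2, h3⟩ := h
  exact ⟨C, h1.trans hmn, h2, fun y hy => h3 y (hZ hy)⟩

lemma Cov.imp {n : ℕ} {Y : Set α} (h : Cov p n Y) (hpq : ∀ s, p s → q s) : Cov q n Y := by
  obtain ⟨C, h1, h2, h3⟩ := h
  exact ⟨C, h1, fun c hc => hpq _ (h2 c hc), h3⟩

lemma cov_one {Y : Set α} (h : p Y) : Cov p 1 Y :=
  ⟨{Y}, by simp, by simpa using h, fun y hy => ⟨Y, by simp, hy⟩⟩

lemma Cov.union {m n : ℕ} {Y Z : Set α} (h : Cov p m Y) (h' : Cov p n Z) :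
    Cov p (m + n) (Y ∪ Z) := by
  obtain ⟨C, h1, h2, h3⟩ := h
  obtain ⟨C', h1', h2', h3'⟩ := h'
  refine ⟨C ∪ C', (Finset.card_union_le _ _).trans (by omega), ?_, ?_⟩
  · intro c hc
    rcases Finset.mem_union.1 hc with h | h
    · exact h2 c h
    · exact h2' c h
  · rintro y (hy | hy)
    · obtain ⟨c, hc, hy⟩ := h3 y hy
      exact ⟨c, Finset.mem_union_left _ hc, hy⟩
    · obtain ⟨c, hc, hy⟩ := h3' y hy
      exact ⟨c, Finset.mem_union_right _ hc, hy⟩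

lemma cov_biUnion {β : Type} {n : ℕ} (I : Finset β) (Y : β → Set α)
    (h : ∀ i ∈ I, Cov p n (Y i)) : Cov p (I.card * n) {v | ∃ i ∈ I, v ∈ Y i} := by
  have h' : ∀ i, ∃ C : Finset (Set α), i ∈ I →
      (C.card ≤ n ∧ (∀ c ∈ C, p c) ∧ ∀ y ∈ Y i, ∃ c ∈ C, y ∈ c) := by
    intro i
    by_cases hi : i ∈ I
    · obtain ⟨C, hC⟩ := h i hi
      exact ⟨C, fun _ => hC⟩
    · exact ⟨∅, fun h => absurd h hi⟩
  choose C hC using h'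
  refine ⟨I.biUnion C, Finset.card_biUnion_le_card_mul _ _ _ (fun i hi => (hC i hi).1), ?_, ?_⟩
  · intro c hc
    obtain ⟨i, hi, hc⟩ := Finset.mem_biUnion.1 hc
    exact (hC i hi).2.1 c hc
  · rintro y ⟨i, hi, hy⟩
    obtain ⟨c, hc, hy⟩ := (hC i hi).2.2 y hy
    exact ⟨c, Finset.mem_biUnion.2 ⟨i, hi, hc⟩, hy⟩

variable {G : Tournament} {L : Set (Set G.V)}

lemma irr (G : Tournament) (v : G.V) : ¬ G.adj v v := fun h => G.asymm _ _ h h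

lemma trans_singleton (v : G.V) : G.IsTransitiveSet {v} := by
  rintro a rfl b rfl c rfl h
  exact absurd h (irr _ _)

lemma free_of_trans (hL : G.IsLaw L) (s : Set G.V) (h : G.IsTransitiveSet s) : Free L s := by
  intro A hA hs
  obtain ⟨x, hx, y, hy, z, hz, h1, h2, h3⟩ := hL A hA
  exact h x (hs hx) y (hs hy) z (hs hz) h1 h2 h3

lemma cov_singletons (hL : G.IsLaw L) (X : Finset G.V) : Cov (Free L) X.card (X : Set G.V) := by
  refine (cov_biUnion (n := 1) X (fun v => {v})
    (fun i _ => cov_one (free_of_trans hL _ (trans_singleton i)))).mono (by simp) ?_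
  intro v hv
  exact ⟨v, hv, rfl⟩

lemma Big.mono {k : ℕ} {X Y : Set G.V} (h : Big G k X) (hXY : X ⊆ Y) : Big G k Y :=
  fun C h1 h2 => h C h1 (fun y hy => h2 y (hXY hy))

lemma cov_of_not_big {k : ℕ} {X : Set G.V} (h : ¬ Big G k X) : Cov G.IsTransitiveSet k X := by
  unfold Big at h
  push Not at h
  obtain ⟨C, h1, h2, h3⟩ := h
  exact ⟨C, h3.le, h1, h2⟩

lemma Big.hit {k : ℕ} {X : Set G.V} (h : Big G k X) {C : Finset (Set G.V)}
    (hC : ∀ c ∈ C, G.IsTransitiveSet c) (hX : ∀ y ∈ X, ∃ c ∈ C, y ∈ c) (hk : C.card ≤ k)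
    {c : Set G.V} (hc : c ∈ C) : ∃ x ∈ X, x ∈ c := by
  by_contra hne
  push Not at hne
  have h1 := h (C.erase c) (fun c' hc' => hC c' (Finset.mem_of_mem_erase hc')) (by
    intro y hy
    obtain ⟨c', hc', hyc⟩ := hX y hy
    refine ⟨c', Finset.mem_erase.2 ⟨?_, hc'⟩, hyc⟩
    rintro rfl
    exact hne y hy hyc)
  have h2 := Finset.card_erase_lt_of_mem hc
  omega

/-- Large domination number gives bounded-size sets of large chromatic number. -/
lemma dom_lemma (k : ℕ) : ∃ K s : ℕ, ∀ (G : Tournament) (Z : Set G.V),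
    (∀ D : Finset G.V, (D : Set G.V) ⊆ Z → D.card ≤ K → ¬ Domi G D Z) →
    ∃ X : Finset G.V, (X : Set G.V) ⊆ Z ∧ X.card ≤ s ∧ Big G k X := by
  induction k with
  | zero => exact ⟨0, 0, fun G Z _ => ⟨∅, by simp, by simp, fun C _ _ => Nat.zero_le _⟩⟩
  | succ k ih =>
    obtain ⟨K, s, ih⟩ := ih
    set m := K + s + 1 with hm
    set M := k * m + 1 with hM
    refine ⟨M + K, s + M + 2 ^ M * s, fun G Z hZ => ?_⟩
    -- minimum dominating set
    have hex : ∃ n, ∃ D : Finset G.V, (D : Set G.V) ⊆ Z ∧ D.card = n ∧ Domi G D Z :=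
      ⟨_, Z.toFinite.toFinset, by simp, rfl, fun y hy => Or.inl (by simpa using hy)⟩
    obtain ⟨D, hDZ, hDc, hD⟩ := Nat.find_spec hex
    have hmin : ∀ E : Finset G.V, (E : Set G.V) ⊆ Z → Domi G E Z → D.card ≤ E.card := by
      intro E hE hE'
      rw [hDc]
      exact Nat.find_min' hex ⟨E, hE, rfl, hE'⟩
    have hDbig : M + K < D.card := by
      by_contra h
      exact hZ D hDZ (by omega) hD
    obtain ⟨W, hWD, hWc⟩ := Finset.exists_subset_card_eq (show M ≤ D.card by omega)
    have hWZ : (W : Set G.V) ⊆ Z := fun x hx => hDZ (hWD hx)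
    obtain ⟨A, hAZ, hAc, hA⟩ := ih G {z | z ∈ Z ∧ z ∉ W ∧ ∀ w ∈ W, ¬ G.adj w z} (by
      intro E hE hEc hdom
      have := hmin (W ∪ E) (by
        intro x hx
        rcases Finset.mem_union.1 (Finset.mem_coe.1 hx) with h | h
        · exact hWZ h
        · exact (hE h).1) (by
        intro y hy
        by_cases h1 : y ∈ W
        · exact Or.inl (Finset.mem_union_left _ h1)
        by_cases h2 : ∃ w ∈ W, G.adj w y
        · obtain ⟨w, hw, h⟩ := h2
          exact Or.inr ⟨w, Finset.mem_union_left _ hw, h⟩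
        · push Not at h2
          rcases hdom y ⟨hy, h1, h2⟩ with h | ⟨x, hx, h⟩
          · exact Or.inl (Finset.mem_union_right _ h)
          · exact Or.inr ⟨x, Finset.mem_union_right _ hx, h⟩)
      have := Finset.card_union_le W E
      omega)
    have hAW : ∀ a ∈ A, ∀ w ∈ W, G.adj a w := by
      intro a ha w hw
      have h := hAZ ha
      rcases G.total a w (by rintro rfl; exact h.2.1 hw) with h' | h'
      · exact h'
      · exact absurd h' (h.2.2 w hw)
    have hB : ∀ S : Finset G.V, ∃ B : Finset G.V, S ⊆ W → S.card = m →
        ((B : Set G.V) ⊆ {z | z ∈ Z ∧ (z ∈ S ∨ ∃ w ∈ S, G.adj w z) ∧ z ∉ A ∧ ∀ a ∈ A, ¬ G.adj a z} ∧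
          B.card ≤ s ∧ Big G k B) := by
      intro S
      by_cases hS : S ⊆ W ∧ S.card = m
      swap
      · exact ⟨∅, fun h1 h2 => absurd ⟨h1, h2⟩ hS⟩
      obtain ⟨hSW, hSc⟩ := hS
      obtain ⟨B, hB⟩ := ih G {z | z ∈ Z ∧ (z ∈ S ∨ ∃ w ∈ S, G.adj w z) ∧ z ∉ A ∧
          ∀ a ∈ A, ¬ G.adj a z} (by
        intro E hE hEc hdom
        have h0 := hmin ((D \ S) ∪ (A ∪ E)) (by
          intro x hx
          rcases Finset.mem_union.1 (Finset.mem_coe.1 hx) with h | h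
          · exact hDZ (Finset.mem_sdiff.1 h).1
          rcases Finset.mem_union.1 h with h | h
          · exact (hAZ h).1
          · exact (hE h).1) (by
          intro y hy
          by_cases h1 : y ∈ A
          · exact Or.inl (by simp [h1])
          by_cases h2 : ∃ a ∈ A, G.adj a y
          · obtain ⟨a, ha, h⟩ := h2
            exact Or.inr ⟨a, by simp [ha], h⟩
          by_cases h3 : y ∈ S ∨ ∃ w ∈ S, G.adj w y
          · push Not at h2
            rcases hdom y ⟨hy, h3, h1, h2⟩ with h | ⟨x, hx, h⟩
            · exact Or.inl (by simp [h])
            · exact Or.inr ⟨x, by simp [hx], h⟩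
          · push Not at h3
            rcases hD y hy with h | ⟨x, hx, h⟩
            · exact Or.inl (by simp [h, h3.1])
            · refine Or.inr ⟨x, ?_, h⟩
              have : x ∉ S := fun hxS => h3.2 x hxS h
              simp [hx, this])
        have h1 := Finset.card_union_le (D \ S) (A ∪ E)
        have h2 := Finset.card_union_le A E
        have h3 := Finset.card_sdiff_of_subset (hSW.trans hWD)
        have h4 := Finset.card_le_card (hSW.trans hWD)
        omega)
      exact ⟨B, fun _ _ => hB⟩
    choose B hB using hB
    refine ⟨A ∪ W ∪ (W.powersetCard m).biUnion B, ?_, ?_, ?_⟩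
    · intro x hx
      rcases Finset.mem_union.1 (Finset.mem_coe.1 hx) with h | h
      · rcases Finset.mem_union.1 h with h | h
        · exact (hAZ h).1
        · exact hWZ h
      · obtain ⟨S, hS, hx⟩ := Finset.mem_biUnion.1 h
        obtain ⟨h1, h2⟩ := Finset.mem_powersetCard.1 hS
        exact ((hB S h1 h2).1 hx).1
    · have h1 := Finset.card_union_le (A ∪ W) ((W.powersetCard m).biUnion B)
      have h2 := Finset.card_union_le A W
      have h3 : ((W.powersetCard m).biUnion B).card ≤ (W.powersetCard m).card * s := by
        refine Finset.card_biUnion_le_card_mul _ _ _ ?_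
        intro S hS
        obtain ⟨h1, h2⟩ := Finset.mem_powersetCard.1 hS
        exact (hB S h1 h2).2.1
      have h4 : (W.powersetCard m).card ≤ 2 ^ M := by
        rw [Finset.card_powersetCard, hWc]
        exact Nat.choose_le_two_pow _ _
      have h5 := Nat.mul_le_mul_right s h4
      omega
    · intro C hC hcov
      by_contra hlt
      have hCk : C.card ≤ k := by omega
      have hWcov : ∀ w ∈ W, ∃ c ∈ C, w ∈ c := fun w hw => hcov w (by simp [hw])
      choose! f hf hf' using hWcov
      obtain ⟨c, hc, hcm⟩ := Finset.exists_lt_card_fiber_of_mul_lt_card_of_maps_to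
        (s := W) (t := C) (f := f) (n := m) hf (by
          have := Nat.mul_le_mul_right m hCk
          omega)
      obtain ⟨S, hS, hSc⟩ := Finset.exists_subset_card_eq hcm.le
      have hSW : S ⊆ W := fun x hx => (Finset.mem_filter.1 (hS hx)).1
      have hScol : ∀ w ∈ S, w ∈ c := fun x hx => by
        have := Finset.mem_filter.1 (hS hx)
        rw [← this.2]
        exact hf' _ this.1
      obtain ⟨hB1, hB2, hB3⟩ := hB S hSW hSc
      obtain ⟨a, ha, hac⟩ := hA.hit hC (fun y hy => hcov y (by
        have : y ∈ A := hy
        simp [this])) hCk hc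
      obtain ⟨b, hb, hbc⟩ := hB3.hit hC (fun y hy => hcov y (by
        have : y ∈ (W.powersetCard m).biUnion B :=
          Finset.mem_biUnion.2 ⟨S, Finset.mem_powersetCard.2 ⟨hSW, hSc⟩, hy⟩
        exact Finset.mem_coe.2 (Finset.mem_union_right _ this))) hCk hc
      have ha : a ∈ A := ha
      obtain ⟨-, h1, h2, h3⟩ := hB1 hb
      rcases h1 with h1 | ⟨w, hw, hwb⟩
      · exact h3 a ha (hAW a ha b (hSW h1))
      · have hba : G.adj b a := by
          rcases G.total b a (by rintro rfl; exact h2 ha) with h | h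
          · exact h
          · exact absurd h (h3 a ha)
        exact hC c hc w (hScol w hw) b hbc a hac hwb hba (hAW a ha w (hSW hw))

/-- If all out-neighbourhoods in `Z` have small `L`-chromatic number, so does `Z`. -/
lemma local_lemma (d t : ℕ) : ∃ g : ℕ, ∀ (G : Tournament) (L : Set (Set G.V)),
    G.IsLaw L → (∀ A ∈ L, ¬ Big G d (NP G A)) → ∀ Z : Set G.V,
    (∀ w ∈ Z, Cov (Free L) t {z | z ∈ Z ∧ G.adj w z}) → Cov (Free L) g Z := by
  obtain ⟨K, s, h⟩ := dom_lemma d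
  refine ⟨K * (1 + t) + (s * (1 + t) + 1), fun G L hL hd Z hZ => ?_⟩
  by_contra hcon
  have key : ∀ D : Finset G.V, (D : Set G.V) ⊆ Z →
      Cov (Free L) (D.card * (1 + t)) {v | ∃ i ∈ D, v ∈ ({i} ∪ {z | z ∈ Z ∧ G.adj i z} : Set G.V)} := by
    intro D hD
    exact cov_biUnion D _ (fun i hi =>
      (cov_one (free_of_trans hL _ (trans_singleton i))).union (hZ i (hD hi)))
  obtain ⟨X, hXZ, hXc, hX⟩ := h G Z (by
    intro D hD hDc hdom
    refine hcon ((key D hD).mono ?_ ?_)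
    · have := Nat.mul_le_mul_right (1 + t) hDc
      omega
    · intro v hv
      rcases hdom v hv with h | ⟨x, hx, h⟩
      · exact ⟨v, h, Or.inl rfl⟩
      · exact ⟨x, hx, Or.inr ⟨hv, h⟩⟩)
  by_cases hfree : Free L {z | z ∈ Z ∧ z ∉ X ∧ ∀ x ∈ X, ¬ G.adj x z}
  · refine hcon (((key X hXZ).union (cov_one hfree)).mono ?_ ?_)
    · have := Nat.mul_le_mul_right (1 + t) hXc
      omega
    · intro v hv
      by_cases h1 : v ∈ X
      · exact Or.inl ⟨v, h1, Or.inl rfl⟩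
      by_cases h2 : ∃ x ∈ X, G.adj x v
      · obtain ⟨x, hx, h⟩ := h2
        exact Or.inl ⟨x, hx, Or.inr ⟨hv, h⟩⟩
      · push Not at h2
        exact Or.inr ⟨hv, h1, h2⟩
  · unfold Free at hfree
    push Not at hfree
    obtain ⟨A, hA, hAs⟩ := hfree
    refine hd A hA (hX.mono ?_)
    intro x hx a ha
    obtain ⟨-, h1, h2⟩ := hAs ha
    rcases G.total a x (by rintro rfl; exact h1 hx) with h | h
    · exact h
    · exact absurd h (h2 x hx)

lemma not_free {F : Set α} {M : Set (Set α)} (h : ¬ Free M F) : ∃ A ∈ M, A ⊆ F := by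
  unfold Free at h
  push Not at h
  exact h

/-- Bounded-size sets all of whose `L`-transversals have large chromatic number. -/
lemma tr_lemma (d ℓ k : ℕ) : ∃ s c : ℕ, ∀ (G : Tournament) (L : Set (Set G.V)),
    G.IsLaw L → (∀ A ∈ L, A.ncard ≤ ℓ) → (∀ A ∈ L, ¬ Big G d (NP G A)) → ∀ Y : Set G.V,
    ¬ Cov (Free L) c Y → ∃ X : Finset G.V, (X : Set G.V) ⊆ Y ∧ X.card ≤ s ∧ Tr G L k X := by
  induction k with
  | zero =>
    exact ⟨0, 0, fun G L _ _ _ Y _ => ⟨∅, by simp, by simp, fun F _ C _ _ => Nat.zero_le _⟩⟩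
  | succ k ih =>
    obtain ⟨s, c, ih⟩ := ih
    set t := d + ℓ * c + (c + 1) with ht
    obtain ⟨g, hg⟩ := local_lemma d t
    refine ⟨ℓ + ℓ * (s + s * s), 1 + (1 + g) + (ℓ + (d + ℓ * t)), ?_⟩
    intro G L hL hℓ hd Y hY
    have hdcov : ∀ A ∈ L, Cov (Free L) d (NP G A) := fun A hA =>
      (cov_of_not_big (hd A hA)).imp (free_of_trans hL)
    have hfin : ∀ A ∈ L, ∃ A' : Finset G.V, (A' : Set G.V) = A ∧ A'.card ≤ ℓ := by
      intro A hA
      refine ⟨A.toFinite.toFinset, by simp, ?_⟩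
      rw [← Set.ncard_eq_toFinset_card A A.toFinite]
      exact hℓ A hA
    set I' : Set G.V := {w | w ∈ Y ∧ Cov (Free L) t {z | z ∈ Y ∧ G.adj z w}} with hI'
    set O' : Set G.V := {w | w ∈ Y ∧ Cov (Free L) t {z | z ∈ Y ∧ G.adj w z}} with hO'
    have hIfree : Free L I' := by
      intro A hA hAI
      obtain ⟨A', rfl, hA'⟩ := hfin A hA
      refine hY (((cov_singletons hL A').union ((hdcov _ hA).union
        (cov_biUnion A' (fun a => {z | z ∈ Y ∧ G.adj z a}) (fun a ha => (hAI ha).2)))).mono ?_ ?_)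
      · have := Nat.mul_le_mul_right t hA'
        omega
      · intro v hv
        by_cases h1 : v ∈ A'
        · exact Or.inl h1
        by_cases h2 : v ∈ NP G A'
        · exact Or.inr (Or.inl h2)
        · simp only [NP, Set.mem_ofPred_eq] at h2
          push Not at h2
          obtain ⟨a, ha, h⟩ := h2
          refine Or.inr (Or.inr ⟨a, ha, hv, ?_⟩)
          rcases G.total v a (by rintro rfl; exact h1 ha) with h' | h'
          · exact h'
          · exact absurd h' h
    have hOcov : Cov (Free L) g O' := by
      refine hg G L hL hd O' ?_
      intro w hw
      exact hw.2.mono le_rfl (fun z hz => ⟨hz.1.1, hz.2⟩)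
    have hJ : ¬ Free L (Y \ (I' ∪ O')) := by
      intro hJ
      refine hY (((cov_one hJ).union ((cov_one hIfree).union hOcov)).mono (by omega) ?_)
      intro v hv
      by_cases h1 : v ∈ I'
      · exact Or.inr (Or.inl h1)
      by_cases h2 : v ∈ O'
      · exact Or.inr (Or.inr h2)
      · exact Or.inl ⟨hv, fun h => h.elim h1 h2⟩
    obtain ⟨W, hW, hWJ⟩ := not_free hJ
    obtain ⟨W', rfl, hW'⟩ := hfin W hW
    have hK : ∀ w : G.V, ∃ K : Finset G.V, w ∈ W' → ((K : Set G.V) ⊆ Y ∧ K.card ≤ s + s * s ∧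
        ∃ X : Finset G.V, X ⊆ K ∧ Tr G L k X ∧ ∀ x ∈ X, G.adj x w ∧
          ∃ B : Finset G.V, B ⊆ K ∧ Tr G L k B ∧ ∀ b ∈ B, G.adj w b ∧ G.adj b x) := by
      intro w
      by_cases hw : w ∈ W'
      swap
      · exact ⟨∅, fun h => absurd h hw⟩
      obtain ⟨hwY, hwn⟩ := hWJ hw
      have hin : ¬ Cov (Free L) t {z | z ∈ Y ∧ G.adj z w} := fun h => hwn (Or.inl ⟨hwY, h⟩)
      have hout : ¬ Cov (Free L) t {z | z ∈ Y ∧ G.adj w z} := fun h => hwn (Or.inr ⟨hwY, h⟩)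
      set bad : Set G.V := {x | (x ∈ Y ∧ G.adj x w) ∧
        Cov (Free L) c {z | z ∈ Y ∧ G.adj w z ∧ G.adj z x}} with hbad
      have hbadfree : Free L bad := by
        intro A hA hAb
        obtain ⟨A', rfl, hA'⟩ := hfin A hA
        refine hout (((hdcov _ hA).union (cov_biUnion A'
          (fun a => {z | z ∈ Y ∧ G.adj w z ∧ G.adj z a}) (fun a ha => (hAb ha).2))).mono ?_ ?_)
        · have := Nat.mul_le_mul_right c hA'
          omega
        · intro v hv
          by_cases h2 : v ∈ NP G A'
          · exact Or.inl h2
          · simp only [NP, Set.mem_ofPred_eq] at h2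
            push Not at h2
            obtain ⟨a, ha, h⟩ := h2
            refine Or.inr ⟨a, ha, hv.1, hv.2, ?_⟩
            rcases G.total v a (by
              rintro rfl
              exact G.asymm _ _ hv.2 (hAb ha).1.2) with h' | h'
            · exact h'
            · exact absurd h' h
      obtain ⟨X, hX1, hX2, hX3⟩ := ih G L hL hℓ hd ({z | z ∈ Y ∧ G.adj z w} \ bad) (by
        intro hc
        refine hin ((hc.union (cov_one hbadfree)).mono (by omega) ?_)
        intro v hv
        by_cases h : v ∈ bad
        · exact Or.inr h
        · exact Or.inl ⟨hv, h⟩)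
      have hB : ∀ x : G.V, ∃ B : Finset G.V, x ∈ X →
          ((B : Set G.V) ⊆ {z | z ∈ Y ∧ G.adj w z ∧ G.adj z x} ∧ B.card ≤ s ∧ Tr G L k B) := by
        intro x
        by_cases hx : x ∈ X
        swap
        · exact ⟨∅, fun h => absurd h hx⟩
        obtain ⟨B, hB⟩ := ih G L hL hℓ hd {z | z ∈ Y ∧ G.adj w z ∧ G.adj z x}
          (fun h => (hX1 hx).2 ⟨(hX1 hx).1, h⟩)
        exact ⟨B, fun _ => hB⟩
      choose B hB using hB
      refine ⟨X ∪ X.biUnion B, fun _ => ⟨?_, ?_, X, Finset.subset_union_left, hX3, ?_⟩⟩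
      · intro v hv
        rcases Finset.mem_union.1 (Finset.mem_coe.1 hv) with h | h
        · exact (hX1 h).1.1
        · obtain ⟨x, hx, h⟩ := Finset.mem_biUnion.1 h
          exact ((hB x hx).1 h).1
      · have h1 := Finset.card_union_le X (X.biUnion B)
        have h2 := Finset.card_biUnion_le_card_mul X B s (fun x hx => (hB x hx).2.1)
        have h3 := Nat.mul_le_mul_right s hX2
        omega
      · intro x hx
        refine ⟨(hX1 hx).1.2, B x, ?_, (hB x hx).2.2, fun b hb => ((hB x hx).1 hb).2⟩
        exact (Finset.subset_biUnion_of_mem B hx).trans Finset.subset_union_right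
    choose K hK using hK
    refine ⟨W' ∪ W'.biUnion K, ?_, ?_, ?_⟩
    · intro v hv
      rcases Finset.mem_union.1 (Finset.mem_coe.1 hv) with h | h
      · exact (hWJ h).1
      · obtain ⟨w, hw, h⟩ := Finset.mem_biUnion.1 h
        exact (hK w hw).1 h
    · have h1 := Finset.card_union_le W' (W'.biUnion K)
      have h2 := Finset.card_biUnion_le_card_mul W' K (s + s * s) (fun x hx => (hK x hx).2.1)
      have h3 := Nat.mul_le_mul_right (s + s * s) hW'
      omega
    · intro F hF C hC hcov
      by_contra hlt
      have hCk : C.card ≤ k := by omega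
      obtain ⟨w, hw, hwF⟩ := Set.not_subset.1 (hF _ hW)
      have hw : w ∈ W' := hw
      obtain ⟨e, he, hwe⟩ := hcov w ⟨by simp [hw], hwF⟩
      obtain ⟨-, -, X, hXK, hX, hX'⟩ := hK w hw
      have hsub : ∀ v ∈ K w, v ∉ F → ∃ c ∈ C, v ∈ c := fun v hv hvF => hcov v
        ⟨Finset.mem_coe.2 (Finset.mem_union_right _ (Finset.mem_biUnion.2 ⟨w, hw, hv⟩)), hvF⟩
      obtain ⟨x, hx, hxe⟩ := (hX F hF).hit hC (fun y hy => hsub y (hXK hy.1) hy.2) hCk he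
      obtain ⟨hxw, B, hBK, hB, hB'⟩ := hX' x hx.1
      obtain ⟨b, hb, hbe⟩ := (hB F hF).hit hC (fun y hy => hsub y (hBK hy.1) hy.2) hCk he
      obtain ⟨hwb, hbx⟩ := hB' b hb.1
      exact hC e he w hwe b hbe x hxe hwb hbx hxw

/-- One-sided version. -/
lemma one_sided (d ℓ : ℕ) : ∃ n : ℕ, ∀ (G : Tournament) (L : Set (Set G.V)),
    G.IsLaw L → (∀ A ∈ L, A.ncard ≤ ℓ) → (∀ A ∈ L, ¬ Big G d (NP G A)) →
    Cov (Free L) n Set.univ := by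
  obtain ⟨s, c, h⟩ := tr_lemma d ℓ d
  refine ⟨c + (s + 2 ^ s * (d + 1)), fun G L hL hℓ hd => ?_⟩
  by_contra hcon
  obtain ⟨X, -, hXc, hX⟩ := h G L hL hℓ hd Set.univ (fun h => hcon (h.mono (by omega) le_rfl))
  refine hcon (((cov_singletons hL X).union (cov_biUnion (n := d + 1) X.powerset
    (fun S => {v | v ∉ X ∧ ∀ x ∈ X, x ∈ S ↔ G.adj v x}) ?_)).mono ?_ ?_)
  · intro S hS
    by_cases hf : Free L ((X : Set G.V) \ S)
    · refine (cov_one ?_).mono (by omega) le_rfl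
      intro A hA hAS
      refine hd A hA ((hX _ hf).mono ?_)
      rintro x ⟨hx, hxS⟩ a ha
      have : x ∈ S := by
        by_contra h
        exact hxS ⟨hx, h⟩
      exact ((hAS ha).2 x hx).1 this
    · obtain ⟨A, hA, hAS⟩ := not_free hf
      refine ((cov_of_not_big (hd A hA)).imp (free_of_trans hL)).mono (by omega) ?_
      intro v hv a ha
      obtain ⟨haX, haS⟩ := hAS ha
      have haX : a ∈ X := haX
      rcases G.total a v (by rintro rfl; exact hv.1 haX) with h | h
      · exact h
      · exact absurd ((hv.2 a haX).2 h) haS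
  · rw [Finset.card_powerset]
    have h1 : 2 ^ X.card ≤ 2 ^ s := Nat.pow_le_pow_right (by norm_num) hXc
    have h2 := Nat.mul_le_mul_right (d + 1) h1
    omega
  · intro v _
    by_cases hv : v ∈ X
    · exact Or.inl hv
    · refine Or.inr ⟨X.filter (fun x => G.adj v x), by simp, hv, ?_⟩
      intro x hx
      simp [hx]

/-- The reversed tournament. -/
def rev (G : Tournament) : Tournament where
  V := G.V
  fintype := G.fintype
  adj := fun u v => G.adj v u
  asymm := fun u v h h' => G.asymm _ _ h h'
  total := fun u v h => (G.total u v h).symm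

lemma rev_trans (s : Set G.V) : (rev G).IsTransitiveSet s ↔ G.IsTransitiveSet s :=
  ⟨fun h a ha b hb c hc h1 h2 h3 => h a ha c hc b hb h3 h2 h1,
   fun h a ha b hb c hc h1 h2 h3 => h a ha c hc b hb h3 h2 h1⟩

lemma rev_law (hL : G.IsLaw L) : (rev G).IsLaw L := by
  intro A hA
  obtain ⟨x, hx, y, hy, z, hz, h1, h2, h3⟩ := hL A hA
  exact ⟨x, hx, z, hz, y, hy, h3, h2, h1⟩

lemma le_chiOn {k : ℕ} {X : Set G.V} (h : Big G k X) : k ≤ G.chiOn X := by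
  have hne : {k | ∃ C : Fin k → Set G.V, (∀ i, G.IsTransitiveSet (C i)) ∧ X ⊆ ⋃ i, C i}.Nonempty := by
    refine ⟨Fintype.card G.V, fun i => {(Fintype.equivFin G.V).symm i},
      fun i => trans_singleton _, ?_⟩
    intro x _
    refine Set.mem_iUnion.2 ⟨Fintype.equivFin G.V x, ?_⟩
    simp
  obtain ⟨C, hC, hX⟩ := Nat.sInf_mem hne
  have := h (Finset.univ.image C) (by
    intro c hc
    obtain ⟨i, -, rfl⟩ := Finset.mem_image.1 hc
    exact hC i) (by
    intro y hy
    obtain ⟨i, hi⟩ := Set.mem_iUnion.1 (hX hy)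
    exact ⟨C i, Finset.mem_image_of_mem _ (Finset.mem_univ _), hi⟩)
  refine this.trans (Finset.card_image_le.trans ?_)
  rw [Finset.card_univ, Fintype.card_fin]
  exact le_rfl

lemma chiLaw_le {n : ℕ} (h : Cov (Free L) n Set.univ) : G.chiLaw L ≤ n := by
  obtain ⟨C, h1, h2, h3⟩ := h
  refine le_trans (Nat.sInf_le ?_) h1
  refine ⟨fun i => (C.equivFin.symm i : Set G.V), fun i => h2 _ (C.equivFin.symm i).2, ?_⟩
  intro v
  obtain ⟨c, hc, hv⟩ := h3 v trivial
  exact ⟨C.equivFin ⟨c, hc⟩, by simpa using hv⟩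

end LawAux

open LawAux in
/-- For all `d, ℓ` there is `n` such that for every tournament `G` and law `L`
of order at most `ℓ`, if `χ_L(G) > n` then some `A ∈ L` has sets `P, Q` disjoint
from `A` with `Q ⇒ A ⇒ P` and `χ(P), χ(Q) ≥ d`. -/
theorem law_in_and_out (d ℓ : ℕ) :
    ∃ n : ℕ, ∀ (G : Tournament) (L : Set (Set G.V)),
      G.IsLaw L → (∀ A ∈ L, A.ncard ≤ ℓ) → n < G.chiLaw L →
      ∃ A ∈ L, ∃ P Q : Set G.V, Disjoint P A ∧ Disjoint Q A ∧
        G.CompleteTo Q A ∧ G.CompleteTo A P ∧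
        d ≤ G.chiOn P ∧ d ≤ G.chiOn Q := by
  classical
  obtain ⟨n, hn⟩ := one_sided d ℓ
  refine ⟨n * n, fun G L hL hℓ hχ => ?_⟩
  by_contra hcon
  have hP : Cov (Free {A | A ∈ L ∧ ¬ Big G d (NP G A)}) n Set.univ :=
    hn G _ (fun A hA => hL A hA.1) (fun A hA => hℓ A hA.1) (fun A hA => hA.2)
  have hQ : Cov (Free {A : Set G.V | A ∈ L ∧ ¬ Big (rev G) d (NP (rev G) A)}) n Set.univ :=
    hn (rev G) {A | A ∈ L ∧ ¬ Big (rev G) d (NP (rev G) A)}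
      (fun A hA => rev_law hL A hA.1) (fun A hA => hℓ A hA.1) (fun A hA => hA.2)
  obtain ⟨C, hC1, hC2, hC3⟩ := hP
  obtain ⟨D, hD1, hD2, hD3⟩ := hQ
  refine absurd (chiLaw_le (L := L) (n := n * n)
    ⟨(C ×ˢ D).image (fun q => q.1 ∩ q.2), ?_, ?_, ?_⟩) (by omega)
  · refine Finset.card_image_le.trans ?_
    rw [Finset.card_product]
    exact Nat.mul_le_mul hC1 hD1
  · intro e he A hA hAe
    obtain ⟨⟨c, c'⟩, hcc, rfl⟩ := Finset.mem_image.1 he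
    obtain ⟨hc, hc'⟩ := Finset.mem_product.1 hcc
    have h1 : Big G d (NP G A) := by
      by_contra h
      exact hC2 c hc A ⟨hA, h⟩ (hAe.trans Set.inter_subset_left)
    have h2 : Big (rev G) d (NP (rev G) A) := by
      by_contra h
      exact hD2 c' hc' A ⟨hA, h⟩ (hAe.trans Set.inter_subset_right)
    have h2' : Big G d (NP (rev G) A) :=
      fun E hE hE' => h2 E (fun e he => (rev_trans (G := G) e).2 (hE e he)) hE'
    refine hcon ⟨A, hA, NP G A, NP (rev G) A, ?_, ?_, ?_, ?_, le_chiOn h1, le_chiOn h2'⟩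
    · exact Set.disjoint_left.2 (fun v hv hvA => irr G v (hv v hvA))
    · exact Set.disjoint_left.2 (fun v hv hvA => irr G v (hv v hvA))
    · exact fun q hq a ha => hq a ha
    · exact fun a ha q hq => hq a ha
  · intro v hv
    obtain ⟨c, hc, h⟩ := hC3 v hv
    obtain ⟨c', hc', h'⟩ := hD3 v hv
    exact ⟨c ∩ c', Finset.mem_image.2 ⟨(c, c'), Finset.mem_product.2 ⟨hc, hc'⟩, rfl⟩, h, h'⟩
end

section
/- Let H be a tournament with χ(H) ≥ 2 and let d ≥ 0 be an integer. Then there exists n such that for every tournament G, either (i) there is a subtournament S of G isomorphic to H and two subsets P, Q ⊆ V(G)∖V(S) with Q ⇒ V(S) and V(S) ⇒ P, such that χ(P) ≥ d and χ(Q) ≥ d; or (ii) V(G) can be partitioned into n subsets each inducing an H-free subtournament. -/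
section helpers
open Set
set_option linter.unusedSectionVars false

/-- generic covering number -/
noncomputable def cn {V : Type} (F : Set V → Prop) (A : Set V) : ℕ :=
  sInf {k | ∃ C : Fin k → Set V, (∀ i, F (C i)) ∧ A ⊆ ⋃ i, C i}

structure OkF {V : Type} (F : Set V → Prop) : Prop where
  empty : F ∅
  single : ∀ v, F {v}

section cover
variable {V : Type} [Fintype V] {F : Set V → Prop}

theorem cn_le_of {V : Type} {F : Set V → Prop} {A : Set V} {k : ℕ} (C : Fin k → Set V)
    (h : ∀ i, F (C i)) (hA : A ⊆ ⋃ i, C i) : cn F A ≤ k := Nat.sInf_le ⟨C, h, hA⟩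

theorem cn_exists (hF : OkF F) (A : Set V) :
    ∃ C : Fin (cn F A) → Set V, (∀ i, F (C i)) ∧ A ⊆ ⋃ i, C i := by
  have : ({k | ∃ C : Fin k → Set V, (∀ i, F (C i)) ∧ A ⊆ ⋃ i, C i} : Set ℕ).Nonempty := by
    refine ⟨Fintype.card V, fun i => {(Fintype.equivFin V).symm i}, fun i => hF.single _, ?_⟩
    intro v _
    exact mem_iUnion.2 ⟨Fintype.equivFin V v, by simp⟩
  exact Nat.sInf_mem this

theorem cn_exists_le (hF : OkF F) {A : Set V} {k : ℕ} (hk : cn F A ≤ k) :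
    ∃ C : Fin k → Set V, (∀ i, F (C i)) ∧ A ⊆ ⋃ i, C i := by
  obtain ⟨C, hC, hA⟩ := cn_exists hF A
  refine ⟨fun i => if h : i.1 < cn F A then C ⟨i, h⟩ else ∅, ?_, ?_⟩
  · intro i
    dsimp only
    split_ifs
    · exact hC _
    · exact hF.empty
  · intro v hv
    obtain ⟨i, hi⟩ := mem_iUnion.1 (hA hv)
    refine mem_iUnion.2 ⟨⟨i.1, i.2.trans_le hk⟩, ?_⟩
    simpa using hi

theorem cn_mono (hF : OkF F) {A B : Set V} (h : A ⊆ B) : cn F A ≤ cn F B := by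
  obtain ⟨C, hC, hA⟩ := cn_exists hF B
  exact cn_le_of C hC (h.trans hA)

theorem cn_union (hF : OkF F) (A B : Set V) : cn F (A ∪ B) ≤ cn F A + cn F B := by
  obtain ⟨C, hC, hA⟩ := cn_exists hF A
  obtain ⟨D, hD, hB⟩ := cn_exists hF B
  refine cn_le_of (Fin.append C D) ?_ ?_
  · intro i
    refine Fin.addCases (fun i => ?_) (fun i => ?_) i
    · simpa using hC i
    · simpa using hD i
  · rintro v (hv | hv)
    · obtain ⟨i, hi⟩ := mem_iUnion.1 (hA hv)
      exact mem_iUnion.2 ⟨Fin.castAdd _ i, by simpa using hi⟩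
    · obtain ⟨i, hi⟩ := mem_iUnion.1 (hB hv)
      exact mem_iUnion.2 ⟨Fin.natAdd _ i, by simpa using hi⟩

theorem cn_le_one {A : Set V} (h : F A) : cn F A ≤ 1 :=
  cn_le_of (fun _ => A) (fun _ => h) (fun _ hv => mem_iUnion.2 ⟨0, hv⟩)

theorem cn_empty : cn F (∅ : Set V) = 0 :=
  Nat.le_zero.1 (cn_le_of (fun i => i.elim0) (fun i => i.elim0) (by simp))

theorem cn_nonempty {A : Set V} (h : 0 < cn F A) : A.Nonempty := by
  rcases A.eq_empty_or_nonempty with rfl | h'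
  · rw [cn_empty] at h; omega
  · exact h'

theorem cn_biUnion (hF : OkF F) {ι : Type} (D : Finset ι) (f : ι → Set V) (t : ℕ)
    (h : ∀ a ∈ D, cn F (f a) ≤ t) : cn F (⋃ a ∈ D, f a) ≤ D.card * t := by
  classical
  induction D using Finset.induction_on with
  | empty => simp [cn_empty]
  | insert a D ha ih =>
    rw [Finset.set_biUnion_insert, Finset.card_insert_of_notMem ha]
    have h1 := cn_union hF (f a) (⋃ x ∈ D, f x)
    have h2 := h a (by simp)
    have h3 := ih (fun b hb => h b (by simp [hb]))
    nlinarith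

theorem cn_finset (hF : OkF F) (D : Finset V) : cn F (D : Set V) ≤ D.card := by
  have := cn_biUnion hF D (fun v => {v}) 1 (fun a _ => cn_le_one (hF.single a))
  rw [mul_one] at this
  exact (cn_mono hF (fun v hv => by simpa using hv)).trans this

theorem cn_avoid (hF : OkF F) (X : Set V) (b : ℕ) (L : List (Set V))
    (h : ∀ B ∈ L, cn F B ≤ b) (hX : b * L.length < cn F X) : ∃ x ∈ X, ∀ B ∈ L, x ∉ B := by
  induction L generalizing X with
  | nil =>
    obtain ⟨x, hx⟩ := cn_nonempty (by simpa using hX)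
    exact ⟨x, hx, by simp⟩
  | cons B L ih =>
    have h1 := cn_union hF (X \ B) B
    have h2 : cn F X ≤ cn F (X \ B ∪ B) := cn_mono hF (by simp)
    have h3 := h B (by simp)
    rw [List.length_cons] at hX
    obtain ⟨x, hx, hx'⟩ := ih (X \ B) (fun B hB => h B (by simp [hB])) (by nlinarith)
    refine ⟨x, hx.1, ?_⟩
    intro B' hB'
    rcases List.mem_cons.1 hB' with rfl | h
    · exact hx.2
    · exact hx' _ h

/-- if `A` is not coverable by fewer than `k` sets, each of `k` covering sets meets `A`. -/
theorem cn_meet {A : Set V} {k : ℕ} (C : Fin k → Set V) (hC : ∀ i, F (C i))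
    (hA : A ⊆ ⋃ i, C i) (hk : k ≤ cn F A) (i : Fin k) : ∃ a ∈ A, a ∈ C i := by
  by_contra hcon
  push Not at hcon
  obtain ⟨m, rfl⟩ : ∃ m, k = m + 1 := ⟨k - 1, by have := i.2; omega⟩
  have : cn F A ≤ m := by
    refine cn_le_of (fun j => C (i.succAbove j)) (fun j => hC _) ?_
    intro v hv
    obtain ⟨l, hl⟩ := mem_iUnion.1 (hA hv)
    have hne : l ≠ i := by rintro rfl; exact hcon v hv hl
    obtain ⟨j, rfl⟩ := Fin.exists_succAbove_eq hne
    exact mem_iUnion.2 ⟨j, hl⟩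
  omega

end cover

namespace Tournament

theorem irrefl' (G : Tournament) (v : G.V) : ¬ G.adj v v := fun h => G.asymm v v h h

theorem okT (G : Tournament) : OkF G.IsTransitiveSet := by
  constructor
  · intro a ha; exact absurd ha (by simp)
  · rintro v a ha b hb c hc h1 h2 h3
    simp only [mem_singleton_iff] at ha hb hc
    subst ha; subst hb
    exact G.irrefl' _ h1

theorem chiOn_eq (G : Tournament) (A : Set G.V) : G.chiOn A = cn G.IsTransitiveSet A := rfl

noncomputable def mu (G H : Tournament) (A : Set G.V) : ℕ :=
  cn (fun B => ¬ G.ContainsOn B H) A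

theorem trans_free {H : Tournament} (hH : 2 ≤ H.chi) (G : Tournament) (A : Set G.V)
    (hA : G.IsTransitiveSet A) : ¬ G.ContainsOn A H := by
  rintro ⟨f, hf, hfA, hadj⟩
  have : H.chi ≤ 1 := by
    refine cn_le_one (F := H.IsTransitiveSet) ?_
    intro a _ b _ c _ h1 h2 h3
    exact hA _ (hfA a) _ (hfA b) _ (hfA c) ((hadj _ _).1 h1) ((hadj _ _).1 h2) ((hadj _ _).1 h3)
  omega

theorem okH {H : Tournament} (hH : 2 ≤ H.chi) (G : Tournament) :
    OkF (fun B : Set G.V => ¬ G.ContainsOn B H) :=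
  ⟨trans_free hH G _ G.okT.empty, fun v => trans_free hH G _ (G.okT.single v)⟩

theorem mu_le_chi {H : Tournament} (hH : 2 ≤ H.chi) (G : Tournament) (A : Set G.V) :
    G.mu H A ≤ G.chiOn A := by
  obtain ⟨C, hC, hA⟩ := cn_exists G.okT A
  exact cn_le_of C (fun i => trans_free hH G _ (hC i)) hA

theorem copy_of_mu {H : Tournament} (G : Tournament) (A : Set G.V) (h : 2 ≤ G.mu H A) :
    G.ContainsOn A H := by
  by_contra h'
  have := cn_le_one (F := fun B : Set G.V => ¬ G.ContainsOn B H) h'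
  rw [mu] at h
  omega

/-- common in-neighbours / out-neighbours of a set -/
def QS (G : Tournament) (A : Set G.V) : Set G.V := {q | ∀ a ∈ A, G.adj q a}
def PS (G : Tournament) (A : Set G.V) : Set G.V := {q | ∀ a ∈ A, G.adj a q}

end Tournament

namespace Tournament

def Dom (G : Tournament) (B : Set G.V) (m : ℕ) : Prop :=
  ∃ D : Finset G.V, ↑D ⊆ B ∧ D.card ≤ m ∧ ∀ b ∈ B, b ∈ D ∨ ∃ z ∈ D, G.adj b z

theorem dom_min (G : Tournament) (B : Set G.V) :
    ∃ D : Finset G.V, ↑D ⊆ B ∧ (∀ b ∈ B, b ∈ D ∨ ∃ z ∈ D, G.adj b z) ∧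
      ∀ m, G.Dom B m → D.card ≤ m := by
  classical
  have hex : ∃ m, G.Dom B m := by
    refine ⟨_, (Set.toFinite B).toFinset, by simp, le_rfl, ?_⟩
    intro b hb
    left
    simpa using hb
  obtain ⟨D, h1, h2, h3⟩ := Nat.find_spec hex
  exact ⟨D, h1, h3, fun m hm => h2.trans (Nat.find_min' hex hm)⟩

theorem hltw (k : ℕ) : ∃ K l : ℕ, ∀ (G : Tournament) (B : Set G.V), ¬ G.Dom B K →
    ∃ A : Finset G.V, ↑A ⊆ B ∧ A.card ≤ l ∧ k + 1 ≤ G.chiOn A := by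
  classical
  induction k with
  | zero =>
    refine ⟨0, 1, fun G B hB => ?_⟩
    have hne : B.Nonempty := by
      by_contra h
      rw [Set.not_nonempty_iff_eq_empty] at h
      exact hB ⟨∅, by simp, by simp, by simp [h]⟩
    obtain ⟨b, hb⟩ := hne
    refine ⟨{b}, by simpa using hb, by simp, ?_⟩
    by_contra hlt
    have h0 : cn G.IsTransitiveSet ((({b} : Finset G.V)) : Set G.V) ≤ 0 := by
      rw [chiOn_eq] at hlt; omega
    obtain ⟨C, _, hA⟩ := cn_exists_le G.okT h0
    obtain ⟨i, _⟩ := mem_iUnion.1 (hA (show b ∈ _ by simp))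
    exact i.elim0
  | succ k ih =>
    obtain ⟨K, l, ih⟩ := ih
    set s := K + l + 1 with hs
    set w := (k + 1) * s with hw
    refine ⟨K + w, w + l + 2 ^ w * l, fun G B hB => ?_⟩
    obtain ⟨D, hDB, hDd, hDm⟩ := G.dom_min B
    have hDcard : w ≤ D.card := by
      by_contra h
      exact hB ⟨D, hDB, by omega, hDd⟩
    obtain ⟨W, hWD, hWc⟩ := Finset.exists_subset_card_eq hDcard
    have hWB : (W : Set G.V) ⊆ B := fun x hx => hDB (hWD hx)
    have hB' : ¬ G.Dom (G.PS W ∩ B) K := by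
      rintro ⟨E, h1, h2, h3⟩
      refine hB ⟨E ∪ W, ?_, (Finset.card_union_le _ _).trans (by omega), ?_⟩
      · intro x hx
        rcases Finset.mem_union.1 (Finset.mem_coe.1 hx) with h | h
        · exact (h1 h).2
        · exact hWB h
      · intro b hb
        by_cases hbW : b ∈ W
        · left; simp [hbW]
        by_cases hbP : b ∈ G.PS W
        · rcases h3 b ⟨hbP, hb⟩ with h | ⟨z, hz, h⟩
          · left; simp [h]
          · right; exact ⟨z, by simp [hz], h⟩
        · simp only [PS, Set.mem_ofPred_eq, not_forall] at hbP
          obtain ⟨a, ha, hab⟩ := hbP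
          right
          refine ⟨a, by simp [Finset.mem_coe.1 ha], ?_⟩
          rcases G.total a b (by rintro rfl; exact hbW ha) with h | h
          · exact absurd h hab
          · exact h
    obtain ⟨A', hA'B, hA'c, hA'χ⟩ := ih G _ hB'
    obtain ⟨a0, ha0⟩ : (A' : Set G.V).Nonempty :=
      cn_nonempty (F := G.IsTransitiveSet) (by rw [← chiOn_eq]; omega)
    have hstep : ∀ W' : Finset G.V, W' ⊆ W → s ≤ W'.card → ∃ A : Finset G.V,
        (↑A ⊆ {b | b ∈ B ∧ (∃ z ∈ W', G.adj b z) ∧ ∀ a ∈ A', G.adj a b}) ∧ A.card ≤ l ∧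
        k + 1 ≤ G.chiOn A := by
      intro W' hW' hsc
      apply ih
      rintro ⟨E, h1, h2, h3⟩
      have hdom : G.Dom B ((D \ W') ∪ E ∪ A').card := by
        refine ⟨(D \ W') ∪ E ∪ A', ?_, le_rfl, ?_⟩
        · intro x hx
          simp only [Finset.coe_union, Finset.coe_sdiff, Set.mem_union] at hx
          rcases hx with (h | h) | h
          · exact hDB h.1
          · exact (h1 h).1
          · exact (hA'B h).2
        · intro b hb
          by_cases hbW : b ∈ W'
          · right
            exact ⟨a0, by simp [Finset.mem_coe.1 ha0], (hA'B ha0).1 b (hW' hbW)⟩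
          by_cases hbD : b ∈ D
          · left; simp [hbD, hbW]
          obtain ⟨z, hz, hbz⟩ : ∃ z ∈ D, G.adj b z := by
            rcases hDd b hb with h | h
            · exact absurd h hbD
            · exact h
          by_cases hzW : z ∈ W'
          · by_cases hbA : b ∈ A'
            · left; simp [hbA]
            by_cases hall : ∀ a ∈ A', G.adj a b
            · rcases h3 b ⟨hb, ⟨z, hzW, hbz⟩, hall⟩ with h | ⟨y, hy, h⟩
              · left; simp [h]
              · right; exact ⟨y, by simp [hy], h⟩
            · push Not at hall
              obtain ⟨a, ha, hab⟩ := hall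
              right
              refine ⟨a, by simp [ha], ?_⟩
              rcases G.total a b (by rintro rfl; exact hbA ha) with h | h
              · exact absurd h hab
              · exact h
          · right; exact ⟨z, by simp [hz, hzW], hbz⟩
      have h4 := hDm _ hdom
      have h5 := Finset.card_union_le ((D \ W') ∪ E) A'
      have h6 := Finset.card_union_le (D \ W') E
      have h7 := Finset.card_sdiff_add_card_eq_card (hW'.trans hWD)
      omega
    choose! AW hAW1 hAW2 hAW3 using hstep
    set T := (W.powerset.filter (fun W' => s ≤ W'.card)).biUnion AW with hT
    refine ⟨W ∪ A' ∪ T, ?_, ?_, ?_⟩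
    · intro x hx
      simp only [Finset.coe_union, Set.mem_union] at hx
      rcases hx with (h | h) | h
      · exact hWB h
      · exact (hA'B h).2
      · rw [Finset.mem_coe, hT, Finset.mem_biUnion] at h
        obtain ⟨W', hW', hx⟩ := h
        rw [Finset.mem_filter, Finset.mem_powerset] at hW'
        exact (hAW1 W' hW'.1 hW'.2 hx).1
    · have h1 := Finset.card_union_le (W ∪ A') T
      have h2 := Finset.card_union_le W A'
      have h3 : T.card ≤ 2 ^ w * l := by
        refine (Finset.card_biUnion_le_card_mul _ _ l ?_).trans ?_
        · intro W' hW'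
          rw [Finset.mem_filter, Finset.mem_powerset] at hW'
          exact hAW2 W' hW'.1 hW'.2
        · refine Nat.mul_le_mul_right _ ((Finset.card_filter_le _ _).trans ?_)
          rw [Finset.card_powerset, hWc]
      omega
    · by_contra hlt
      obtain ⟨C, hC, hCA⟩ := cn_exists_le (k := k + 1) G.okT
        (A := ((W ∪ A' ∪ T : Finset G.V) : Set G.V)) (by rw [← chiOn_eq]; omega)
      have hcol : ∀ v ∈ W, ∃ i, v ∈ C i := fun v hv =>
        mem_iUnion.1 (hCA (by simp [hv]))
      choose! col hcol using hcol
      obtain ⟨i, _, hi⟩ := Finset.exists_le_card_fiber_of_mul_le_card_of_maps_to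
        (s := W) (t := (Finset.univ : Finset (Fin (k+1)))) (f := col) (n := s)
        (fun _ _ => Finset.mem_univ _) ⟨0, Finset.mem_univ _⟩ (by simp [hWc, hw])
      set W' := W.filter (fun x => col x = i) with hW'
      have hsub : W' ⊆ W := Finset.filter_subset _ _
      have hsubT : AW W' ⊆ T := by
        rw [hT]
        exact Finset.subset_biUnion_of_mem AW
          (Finset.mem_filter.2 ⟨Finset.mem_powerset.2 hsub, hi⟩)
      obtain ⟨a, ha, hai⟩ := cn_meet C hC (A := (AW W' : Set G.V))
        (fun x hx => hCA (by
          have := hsubT hx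
          simp [this])) (hAW3 W' hsub hi) i
      obtain ⟨a', ha', ha'i⟩ := cn_meet C hC (A := (A' : Set G.V))
        (fun x hx => hCA (by simp [Finset.mem_coe.1 hx])) hA'χ i
      obtain ⟨_, ⟨z, hz, haz⟩, hall⟩ := hAW1 W' hsub hi ha
      have hzW := hsub hz
      have hzi : z ∈ C i := by
        have h1 := hcol z hzW
        rwa [(Finset.mem_filter.1 hz).2] at h1
      exact hC i a hai z hzi a' ha'i haz ((hA'B ha').1 z hzW) (hall a' ha')

end Tournament

namespace Tournament

variable {H : Tournament}

theorem mu_mono (hH : 2 ≤ H.chi) (G : Tournament) {A B : Set G.V} (h : A ⊆ B) :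
    G.mu H A ≤ G.mu H B := cn_mono (okH hH G) h

theorem mu_cover (hH : 2 ≤ H.chi) (G : Tournament) (Y Q : Set G.V) (A : Finset G.V)
    (f : G.V → Set G.V) (c : ℕ) (hf : ∀ a ∈ A, G.mu H (f a) ≤ c)
    (hY : ∀ y ∈ Y, y ∈ Q ∨ y ∈ A ∨ ∃ a ∈ A, y ∈ f a) :
    G.mu H Y ≤ G.mu H Q + A.card * c + A.card := by
  have h1 := cn_union (okH hH G) (Q ∪ ⋃ a ∈ A, f a) A
  have h2 := cn_union (okH hH G) Q (⋃ a ∈ A, f a)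
  have h3 := cn_biUnion (okH hH G) A f c hf
  have h4 := cn_finset (okH hH G) A
  have h5 : G.mu H Y ≤ G.mu H ((Q ∪ ⋃ a ∈ A, f a) ∪ A) := by
    refine mu_mono hH G ?_
    intro y hy
    rcases hY y hy with h | h | ⟨a, ha, h⟩
    · exact Or.inl (Or.inl h)
    · exact Or.inr h
    · exact Or.inl (Or.inr (by simp only [mem_iUnion]; exact ⟨a, ha, h⟩))
  unfold mu at *
  omega

theorem mu_cover_Q (hH : 2 ≤ H.chi) (G : Tournament) (Y : Set G.V) (A : Finset G.V) (c : ℕ)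
    (hc : ∀ a ∈ A, G.mu H (G.outN a ∩ Y) ≤ c) :
    G.mu H Y ≤ G.mu H (G.QS A ∩ Y) + A.card * c + A.card := by
  refine mu_cover hH G Y _ A _ c hc ?_
  intro y hy
  by_cases hA : y ∈ A
  · exact Or.inr (Or.inl hA)
  by_cases hQ : y ∈ G.QS A
  · exact Or.inl ⟨hQ, hy⟩
  · simp only [QS, Set.mem_ofPred_eq, not_forall] at hQ
    obtain ⟨a, ha, hya⟩ := hQ
    rcases G.total y a (by rintro rfl; exact hA ha) with h | h
    · exact absurd h hya
    · exact Or.inr (Or.inr ⟨a, ha, h, hy⟩)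

theorem mu_cover_P (hH : 2 ≤ H.chi) (G : Tournament) (Y : Set G.V) (A : Finset G.V) (c : ℕ)
    (hc : ∀ a ∈ A, G.mu H (G.inN a ∩ Y) ≤ c) :
    G.mu H Y ≤ G.mu H (G.PS A ∩ Y) + A.card * c + A.card := by
  refine mu_cover hH G Y _ A _ c hc ?_
  intro y hy
  by_cases hA : y ∈ A
  · exact Or.inr (Or.inl hA)
  by_cases hQ : y ∈ G.PS A
  · exact Or.inl ⟨hQ, hy⟩
  · simp only [PS, Set.mem_ofPred_eq, not_forall] at hQ
    obtain ⟨a, ha, hya⟩ := hQ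
    rcases G.total y a (by rintro rfl; exact hA ha) with h | h
    · exact Or.inr (Or.inr ⟨a, ha, h, hy⟩)
    · exact absurd h hya

/-- every copy of `H` in `W` has few common in-neighbours -/
def NoIn (G H : Tournament) (W : Set G.V) (d : ℕ) : Prop :=
  ∀ f : H.V → G.V, Function.Injective f → (∀ u, f u ∈ W) →
    (∀ u v, H.adj u v ↔ G.adj (f u) (f v)) → G.chiOn (G.QS (Set.range f)) < d

theorem chiOn_mono (G : Tournament) {A B : Set G.V} (h : A ⊆ B) : G.chiOn A ≤ G.chiOn B :=
  cn_mono G.okT h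

/-- no large set `A` has a copy among its common out-neighbours -/
theorem NoIn.contra {G : Tournament} {W : Set G.V} {d : ℕ} (hN : NoIn G H W d)
    {A X : Set G.V} (hX : X ⊆ W) (hA : d ≤ G.chiOn A) (h2 : 2 ≤ G.mu H (G.PS A ∩ X)) : False := by
  obtain ⟨f, hf, hfA, hadj⟩ := copy_of_mu G _ h2
  have h1 := hN f hf (fun u => hX (hfA u).2) hadj
  have h3 : G.chiOn A ≤ G.chiOn (G.QS (Set.range f)) := by
    refine chiOn_mono G ?_
    rintro a ha _ ⟨u, rfl⟩
    exact (hfA u).1 a ha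
  omega

theorem local_case (hH : 2 ≤ H.chi) (d : ℕ) : ∃ F : ℕ → ℕ, ∀ (t : ℕ) (G : Tournament)
    (W X : Set G.V), NoIn G H W d → X ⊆ W → (∀ w ∈ X, G.mu H (G.inN w ∩ X) ≤ t) →
    G.mu H X ≤ F t := by
  obtain ⟨K, l, hKl⟩ := hltw d
  refine ⟨fun t => (K * t + K) + (l * t + l + 1), fun t G W X hN hX ht => ?_⟩
  dsimp only
  by_cases hD : G.Dom X K
  · obtain ⟨D, hDX, hDc, hDd⟩ := hD
    have := mu_cover hH G X ∅ D (fun a => G.inN a ∩ X) t (fun a ha => ht a (hDX ha)) (by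
      intro y hy
      rcases hDd y hy with h | ⟨z, hz, h⟩
      · exact Or.inr (Or.inl h)
      · exact Or.inr (Or.inr ⟨z, hz, h, hy⟩))
    have h0 : G.mu H ∅ = 0 := cn_empty
    have h1 := Nat.mul_le_mul_right t hDc
    omega
  · obtain ⟨A, hAX, hAc, hAχ⟩ := hKl G X hD
    have h1 := mu_cover_P hH G X A t (fun a ha => ht a (hAX ha))
    have h2 : ¬ 2 ≤ G.mu H (G.PS A ∩ X) := fun h => hN.contra hX (A := A) (by omega) h
    have h3 := Nat.mul_le_mul_right t hAc
    omega

theorem right_small (hH : 2 ≤ H.chi) {d : ℕ} {G : Tournament} {W : Set G.V} (hN : NoIn G H W d)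
    (Y : Set G.V) (c : ℕ) (hY : Fintype.card H.V * c + Fintype.card H.V + d ≤ G.mu H Y) :
    G.mu H {x | x ∈ W ∧ G.mu H (G.outN x ∩ Y) ≤ c} ≤ 1 := by
  classical
  by_contra hlt
  obtain ⟨f, hf, hfA, hadj⟩ := copy_of_mu G _ (Nat.lt_of_not_le hlt)
  have h1 := hN f hf (fun u => (hfA u).1) hadj
  have h2 := mu_cover_Q hH G Y (Finset.univ.image f) c (by
    intro a ha
    obtain ⟨u, _, rfl⟩ := Finset.mem_image.1 ha
    exact (hfA u).2)
  have h3 : (Finset.univ.image f).card = Fintype.card H.V := by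
    rw [Finset.card_image_of_injective _ hf, Finset.card_univ]
  rw [h3, Finset.coe_image, Finset.coe_univ, Set.image_univ] at h2
  have h4 := mu_le_chi hH G (G.QS (Set.range f) ∩ Y)
  have h5 : G.chiOn (G.QS (Set.range f) ∩ Y) ≤ _ := chiOn_mono G Set.inter_subset_left
  omega

theorem delta_s14 (G : Tournament) (k : ℕ) (w : G.V) (A A' : Set G.V) (hA : k ≤ G.chiOn A)
    (hA' : k ≤ G.chiOn A') (h1 : ∀ a ∈ A, G.adj a w) (h2 : ∀ a ∈ A', G.adj w a)
    (h3 : ∀ a ∈ A', ∀ b ∈ A, G.adj a b) : k + 1 ≤ G.chiOn ({w} ∪ A ∪ A') := by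
  by_contra hlt
  obtain ⟨C, hC, hCA⟩ := cn_exists_le (k := k) G.okT (A := {w} ∪ A ∪ A')
    (by rw [← chiOn_eq]; omega)
  obtain ⟨i, hi⟩ := mem_iUnion.1 (hCA (show w ∈ _ from Or.inl (Or.inl rfl)))
  obtain ⟨a, ha, hai⟩ := cn_meet C hC (fun x hx => hCA (Or.inl (Or.inr hx))) hA i
  obtain ⟨b, hb, hbi⟩ := cn_meet C hC (fun x hx => hCA (Or.inr hx)) hA' i
  exact hC i a hai w hi b hbi (h1 a ha) (h2 b hb) (h3 b hb a ha)

theorem claim (hH : 2 ≤ H.chi) (d k : ℕ) : ∀ c r : ℕ, ∃ N : ℕ, ∀ (G : Tournament) (W : Set G.V),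
    NoIn G H W d → ∀ (X : Set G.V) (L : List (Set G.V)), X ⊆ W → N ≤ G.mu H X →
    L.length ≤ r → (∀ Y ∈ L, N ≤ G.mu H Y) →
    ∃ A : Set G.V, A ⊆ X ∧ k ≤ G.chiOn A ∧ ∀ Y ∈ L, c ≤ G.mu H (G.PS A ∩ Y) := by
  obtain ⟨F, hF⟩ := local_case (H := H) hH d
  induction k with
  | zero =>
    intro c r
    refine ⟨c, fun G W _ X L _ _ _ hL => ⟨∅, by simp, by simp, fun Y hY => ?_⟩⟩
    have : G.PS ∅ ∩ Y = Y := by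
      ext y; simp [PS]
    rw [this]; exact hL Y hY
  | succ k ih =>
    intro c r
    obtain ⟨N1, hN1⟩ := ih c r
    obtain ⟨N2, hN2⟩ := ih N1 (r + 1)
    refine ⟨(Fintype.card H.V * N2 + Fintype.card H.V + d) + (F N2 + 1) * (r + 2) + 1,
      fun G W hN X L hXW hX hr hL => ?_⟩
    set b := F N2 + 1 with hb
    obtain ⟨w, hwX, hw⟩ := cn_avoid (okH hH G) X b
      ({x | x ∈ X ∧ G.mu H (G.inN x ∩ X) ≤ N2} ::
        (X :: L).map (fun Y => {x | x ∈ W ∧ G.mu H (G.outN x ∩ Y) ≤ N2}))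
      (by
        intro B hB
        rcases List.mem_cons.1 hB with rfl | hB
        · have := hF N2 G W {x | x ∈ X ∧ G.mu H (G.inN x ∩ X) ≤ N2} hN (fun x hx => hXW hx.1)
            (fun x hx => (mu_mono hH G (Set.inter_subset_inter_right _ (fun y hy => hy.1))).trans
              hx.2)
          unfold mu at this
          unfold mu
          omega
        · obtain ⟨Y, hY, rfl⟩ := List.mem_map.1 hB
          have hYN : Fintype.card H.V * N2 + Fintype.card H.V + d ≤ G.mu H Y := by
            rcases List.mem_cons.1 hY with rfl | hY
            · omega
            · have := hL Y hY; omega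
          have := right_small hH hN Y N2 hYN
          unfold mu at this
          unfold mu
          omega)
      (by
        have h1 : b * (L.length + 2) ≤ b * (r + 2) := Nat.mul_le_mul_left _ (by omega)
        simp only [List.length_cons, List.length_map]
        unfold mu at hX
        have e : L.length + 1 + 1 = L.length + 2 := rfl
        rw [e]
        omega)
    have hwin : N2 ≤ G.mu H (G.inN w ∩ X) := by
      by_contra h
      exact hw _ (List.mem_cons.2 (Or.inl rfl)) ⟨hwX, by omega⟩
    have hwout : ∀ Y ∈ X :: L, N2 ≤ G.mu H (G.outN w ∩ Y) := by
      intro Y hY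
      by_contra h
      exact hw _ (List.mem_cons_of_mem _ (List.mem_map.2 ⟨Y, hY, rfl⟩)) ⟨hXW hwX, by omega⟩
    obtain ⟨A', hA'X, hA'k, hA'⟩ := hN2 G W hN (G.outN w ∩ X)
      ((G.inN w ∩ X) :: L.map (fun Y => G.outN w ∩ Y))
      (Set.inter_subset_right.trans hXW) (hwout X (by simp)) (by simpa using hr)
      (by
        intro Y hY
        rcases List.mem_cons.1 hY with rfl | hY
        · exact hwin
        · obtain ⟨Z, hZ, rfl⟩ := List.mem_map.1 hY
          exact hwout Z (by simp [hZ]))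
    obtain ⟨A, hAX, hAk, hA⟩ := hN1 G W hN (G.PS A' ∩ (G.inN w ∩ X))
      (L.map (fun Y => G.PS A' ∩ (G.outN w ∩ Y)))
      ((Set.inter_subset_right.trans Set.inter_subset_right).trans hXW)
      (hA' _ (by simp)) (by simpa using hr)
      (by
        intro Y hY
        obtain ⟨Z, hZ, rfl⟩ := List.mem_map.1 hY
        exact hA' _ (List.mem_cons_of_mem _ (List.mem_map.2 ⟨Z, hZ, rfl⟩)))
    refine ⟨{w} ∪ A ∪ A', ?_, ?_, ?_⟩
    · rintro x ((h | h) | h)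
      · rw [Set.mem_singleton_iff] at h; rw [h]; exact hwX
      · exact (hAX h).2.2
      · exact (hA'X h).2
    · exact delta_s14 G k w A A' hAk hA'k (fun a ha => (hAX ha).2.1) (fun a ha => (hA'X ha).1)
        (fun a ha b hb => (hAX hb).1 a ha)
    · intro Y hY
      refine (hA _ (List.mem_map.2 ⟨Y, hY, rfl⟩)).trans (mu_mono hH G ?_)
      rintro y ⟨h1, h2, h3, h4⟩
      refine ⟨?_, h4⟩
      rintro a ((h | h) | h)
      · rw [Set.mem_singleton_iff] at h; rw [h]; exact h3
      · exact h1 a h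
      · exact h2 a h

theorem one_sided (hH : 2 ≤ H.chi) (d : ℕ) : ∃ N : ℕ, ∀ (G : Tournament) (W : Set G.V),
    NoIn G H W d → G.mu H W ≤ N := by
  obtain ⟨N, hN⟩ := claim hH d d 2 1
  refine ⟨N, fun G W h => ?_⟩
  by_contra hlt
  obtain ⟨A, _, hAd, hA⟩ := hN G W h W [W] subset_rfl (by omega) (by simp)
    (by intro Y hY; rw [List.mem_singleton] at hY; rw [hY]; omega)
  exact h.contra subset_rfl hAd (hA W (by simp))

/-- the reversed tournament -/
def rev (G : Tournament) : Tournament where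
  V := G.V
  fintype := G.fintype
  adj u v := G.adj v u
  asymm u v h := G.asymm v u h
  total u v h := (G.total u v h).symm

theorem rev_trans (G : Tournament) (A : Set G.V) :
    G.rev.IsTransitiveSet A ↔ G.IsTransitiveSet A := by
  constructor
  · intro h a ha b hb c hc h1 h2 h3
    exact h c hc b hb a ha h2 h1 h3
  · intro h a ha b hb c hc h1 h2 h3
    exact h c hc b hb a ha h2 h1 h3

theorem rev_chiOn (G : Tournament) (A : Set G.V) : G.rev.chiOn A = G.chiOn A := by
  have : G.rev.IsTransitiveSet = G.IsTransitiveSet := funext fun A => propext (G.rev_trans A)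
  exact congrArg (fun F => cn F A) this

theorem rev_contains (G H : Tournament) (A : Set G.V) :
    G.rev.ContainsOn A H.rev ↔ G.ContainsOn A H := by
  constructor
  · rintro ⟨f, h1, h2, h3⟩
    exact ⟨f, h1, h2, fun u v => h3 v u⟩
  · rintro ⟨f, h1, h2, h3⟩
    exact ⟨f, h1, h2, fun u v => h3 v u⟩

theorem rev_mu (G H : Tournament) (A : Set G.V) : G.rev.mu H.rev A = G.mu H A := by
  have : (fun B : Set G.V => ¬ G.rev.ContainsOn B H.rev) = fun B => ¬ G.ContainsOn B H :=
    funext fun A => propext (not_congr (rev_contains G H A))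
  exact congrArg (fun F => cn F A) this

theorem one_sided_out (hH : 2 ≤ H.chi) (d : ℕ) : ∃ N : ℕ, ∀ (G : Tournament) (W : Set G.V),
    (∀ f : H.V → G.V, Function.Injective f → (∀ u, f u ∈ W) →
    (∀ u v, H.adj u v ↔ G.adj (f u) (f v)) → G.chiOn (G.PS (Set.range f)) < d) →
    G.mu H W ≤ N := by
  have hH' : 2 ≤ H.rev.chi := by
    have : H.rev.chi = H.chi := rev_chiOn H Set.univ
    omega
  obtain ⟨N, hN⟩ := one_sided hH' d
  refine ⟨N, fun G W h => ?_⟩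
  rw [← rev_mu]
  refine hN G.rev W ?_
  intro f h1 h2 h3
  have := h f h1 h2 (fun u v => h3 v u)
  rw [← rev_chiOn] at this
  exact this

/-- failure of the first outcome -/
def NoBoth (G H : Tournament) (d : ℕ) : Prop :=
  ∀ f : H.V → G.V, Function.Injective f → (∀ u v, H.adj u v ↔ G.adj (f u) (f v)) →
    d ≤ G.chiOn (G.PS (Set.range f)) → d ≤ G.chiOn (G.QS (Set.range f)) → False

theorem mixed (hH : 2 ≤ H.chi) (d : ℕ) : ∃ n0 : ℕ, ∀ (G : Tournament), NoBoth G H d →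
    ∀ (c : ℕ) (Y : Set G.V),
    Fintype.card H.V * c + Fintype.card H.V + d ≤ G.mu H Y →
    G.mu H {x | G.mu H (G.inN x ∩ Y) ≤ c ∨ G.mu H (G.outN x ∩ Y) ≤ c} ≤ n0 := by
  classical
  obtain ⟨n1, h1⟩ := one_sided hH d
  obtain ⟨n2, h2⟩ := one_sided_out hH d
  refine ⟨n1 + n2, fun G hG c Y hY => ?_⟩
  have e1 : G.mu H {x | G.mu H (G.inN x ∩ Y) ≤ c} ≤ n1 := by
    refine h1 G _ ?_
    intro f hf hfA hadj
    by_contra hlt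
    refine hG f hf hadj ?_ (by omega)
    have h2 := mu_cover_P hH G Y (Finset.univ.image f) c (by
      intro a ha
      obtain ⟨u, _, rfl⟩ := Finset.mem_image.1 ha
      exact (hfA u))
    have h3 : (Finset.univ.image f).card = Fintype.card H.V := by
      rw [Finset.card_image_of_injective _ hf, Finset.card_univ]
    rw [h3, Finset.coe_image, Finset.coe_univ, Set.image_univ] at h2
    have h4 := mu_le_chi hH G (G.PS (Set.range f) ∩ Y)
    have h5 : G.chiOn (G.PS (Set.range f) ∩ Y) ≤ _ := chiOn_mono G Set.inter_subset_left
    omega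
  have e2 : G.mu H {x | G.mu H (G.outN x ∩ Y) ≤ c} ≤ n2 := by
    refine h2 G _ ?_
    intro f hf hfA hadj
    by_contra hlt
    refine hG f hf hadj (by omega) ?_
    have h2 := mu_cover_Q hH G Y (Finset.univ.image f) c (by
      intro a ha
      obtain ⟨u, _, rfl⟩ := Finset.mem_image.1 ha
      exact (hfA u))
    have h3 : (Finset.univ.image f).card = Fintype.card H.V := by
      rw [Finset.card_image_of_injective _ hf, Finset.card_univ]
    rw [h3, Finset.coe_image, Finset.coe_univ, Set.image_univ] at h2
    have h4 := mu_le_chi hH G (G.QS (Set.range f) ∩ Y)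
    have h5 : G.chiOn (G.QS (Set.range f) ∩ Y) ≤ _ := chiOn_mono G Set.inter_subset_left
    omega
  exact (cn_union (okH hH G) {x | G.mu H (G.inN x ∩ Y) ≤ c}
    {x | G.mu H (G.outN x ∩ Y) ≤ c}).trans (Nat.add_le_add e1 e2)

theorem greedy (hH : 2 ≤ H.chi) (d : ℕ) (s : Finset H.V) : ∃ N : ℕ, ∀ (G : Tournament),
    NoBoth G H d → ∀ (C : H.V → Set G.V) (P0 Q0 : Set G.V), (∀ u ∈ s, N ≤ G.mu H (C u)) →
    N ≤ G.mu H P0 → N ≤ G.mu H Q0 →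
    ∃ f : {u // u ∈ s} → G.V, (∀ u : {u // u ∈ s}, f u ∈ C u.1) ∧
      (∀ u v : {u // u ∈ s}, H.adj u.1 v.1 → G.adj (f u) (f v)) ∧
      d ≤ G.mu H (G.PS (Set.range f) ∩ P0) ∧ d ≤ G.mu H (G.QS (Set.range f) ∩ Q0) := by
  classical
  obtain ⟨n0, hmix⟩ := mixed hH d
  induction s using Finset.induction_on with
  | empty =>
    refine ⟨d, fun G _ C P0 Q0 _ hP hQ => ⟨fun u => absurd u.2 (Finset.notMem_empty _), ?_, ?_, ?_, ?_⟩⟩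
    · intro u; exact absurd u.2 (Finset.notMem_empty _)
    · intro u; exact absurd u.2 (Finset.notMem_empty _)
    · refine hP.trans (mu_mono hH G fun x hx => ⟨?_, hx⟩)
      rintro _ ⟨u, _⟩
      exact absurd u.2 (Finset.notMem_empty _)
    · refine hQ.trans (mu_mono hH G fun x hx => ⟨?_, hx⟩)
      rintro _ ⟨u, _⟩
      exact absurd u.2 (Finset.notMem_empty _)
  | insert a s ha ih =>
    obtain ⟨N, hN⟩ := ih
    refine ⟨(Fintype.card H.V * N + Fintype.card H.V + d) + n0 * (s.card + 2) + 1,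
      fun G hG C P0 Q0 hC hP hQ => ?_⟩
    obtain ⟨x, hx, hxL⟩ := cn_avoid (okH hH G) (C a) n0
      ((P0 :: Q0 :: s.toList.map C).map
        (fun Y => {x | G.mu H (G.inN x ∩ Y) ≤ N ∨ G.mu H (G.outN x ∩ Y) ≤ N}))
      (by
        intro B hB
        obtain ⟨Y, hY, rfl⟩ := List.mem_map.1 hB
        refine hmix G hG N Y ?_
        simp only [List.mem_cons, List.mem_map, Finset.mem_toList] at hY
        rcases hY with rfl | rfl | ⟨u, hu, rfl⟩
        · omega
        · omega
        · have := hC u (by simp [hu])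
          omega)
      (by
        have := hC a (by simp)
        simp only [List.length_cons, List.length_map, Finset.length_toList]
        unfold mu at this
        have e : s.card + 1 + 1 = s.card + 2 := rfl
        rw [e]
        omega)
    have hx2 : ∀ Y ∈ P0 :: Q0 :: s.toList.map C,
        N ≤ G.mu H (G.inN x ∩ Y) ∧ N ≤ G.mu H (G.outN x ∩ Y) := by
      intro Y hY
      have := hxL _ (List.mem_map.2 ⟨Y, hY, rfl⟩)
      simp only [Set.mem_ofPred_eq, not_or] at this
      omega
    have hxC : ∀ u ∈ s, N ≤ G.mu H (G.inN x ∩ C u) ∧ N ≤ G.mu H (G.outN x ∩ C u) := by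
      intro u hu
      apply hx2
      simp only [List.mem_cons, List.mem_map, Finset.mem_toList]
      exact Or.inr (Or.inr ⟨u, hu, rfl⟩)
    obtain ⟨f, hf1, hf2, hf3, hf4⟩ := hN G hG
      (fun u => (if H.adj a u then G.outN x else G.inN x) ∩ C u)
      (G.outN x ∩ P0) (G.inN x ∩ Q0)
      (by
        intro u hu
        split_ifs
        · exact (hxC u hu).2
        · exact (hxC u hu).1)
      (hx2 P0 (by simp)).2 (hx2 Q0 (by simp)).1
    have hmem : ∀ u : {u // u ∈ insert a s}, u.1 ≠ a → u.1 ∈ s := by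
      intro u hu
      rcases Finset.mem_insert.1 u.2 with h | h
      · exact absurd h hu
      · exact h
    set g : {u // u ∈ insert a s} → G.V :=
      fun u => if h : u.1 = a then x else f ⟨u.1, hmem u h⟩ with hg
    have hga : ∀ u : {u // u ∈ insert a s}, u.1 = a → g u = x := fun u h => by simp [hg, h]
    have hgs : ∀ (u : {u // u ∈ insert a s}) (h : u.1 ≠ a), g u = f ⟨u.1, hmem u h⟩ := fun u h => by simp [hg, h]
    refine ⟨g, ?_, ?_, ?_, ?_⟩
    · intro u
      by_cases h : u.1 = a
      · rw [hga u h, h]; exact hx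
      · rw [hgs u h]; exact (hf1 ⟨u.1, hmem u h⟩).2
    · intro u v huv
      by_cases h : u.1 = a <;> by_cases h' : v.1 = a
      · rw [h, h'] at huv; exact absurd huv (H.irrefl' _)
      · rw [hga u h, hgs v h']
        have := (hf1 ⟨v.1, hmem v h'⟩).1
        rw [h] at huv
        rw [if_pos huv] at this
        exact this
      · rw [hgs u h, hga v h']
        have := (hf1 ⟨u.1, hmem u h⟩).1
        rw [h'] at huv
        rw [if_neg (H.asymm _ _ huv)] at this
        exact this
      · rw [hgs u h, hgs v h']
        exact hf2 _ _ huv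
    · refine hf3.trans (mu_mono hH G ?_)
      rintro y ⟨h1, h2, h3⟩
      refine ⟨?_, h3⟩
      rintro _ ⟨u, rfl⟩
      by_cases h : u.1 = a
      · rw [hga u h]; exact h2
      · rw [hgs u h]; exact h1 _ ⟨_, rfl⟩
    · refine hf4.trans (mu_mono hH G ?_)
      rintro y ⟨h1, h2, h3⟩
      refine ⟨?_, h3⟩
      rintro _ ⟨u, rfl⟩
      by_cases h : u.1 = a
      · rw [hga u h]; exact h2
      · rw [hgs u h]; exact h1 _ ⟨_, rfl⟩

end Tournament
end helpers

/-- For every tournament `H` with `χ(H) ≥ 2` and every `d`, there is `n` such that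
every tournament `G` either has a copy `S` of `H` together with sets `P, Q` with
`Q ⇒ V(S) ⇒ P` and `χ(P), χ(Q) ≥ d`, or `V(G)` can be partitioned into `n`
`H`-free parts. -/
theorem H_in_and_out (H : Tournament) (hH : 2 ≤ H.chi) (d : ℕ) :
    ∃ n : ℕ, ∀ G : Tournament,
      (∃ f : H.V → G.V, Function.Injective f ∧
          (∀ u v, H.adj u v ↔ G.adj (f u) (f v)) ∧
          ∃ P Q : Set G.V,
            Disjoint P (Set.range f) ∧ Disjoint Q (Set.range f) ∧
            G.CompleteTo Q (Set.range f) ∧ G.CompleteTo (Set.range f) P ∧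
            d ≤ G.chiOn P ∧ d ≤ G.chiOn Q) ∨
      (∃ C : Fin n → Set G.V, (∀ v, ∃ i, v ∈ C i) ∧
          ∀ i, ¬ G.ContainsOn (C i) H) := by
  classical
  obtain ⟨N, hN⟩ := Tournament.greedy hH d Finset.univ
  refine ⟨N, fun G => ?_⟩
  by_cases hmu : G.mu H Set.univ ≤ N
  · right
    obtain ⟨C, hC, hA⟩ := cn_exists_le (Tournament.okH hH G) hmu
    exact ⟨C, fun v => Set.mem_iUnion.1 (hA (Set.mem_univ v)), hC⟩
  · left
    by_contra hcon
    have hNB : G.NoBoth H d := by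
      intro f hf hadj hP hQ
      refine hcon ⟨f, hf, hadj, G.PS (Set.range f), G.QS (Set.range f), ?_, ?_, ?_, ?_, hP, hQ⟩
      · exact Set.disjoint_left.2 fun x hx hx' => G.irrefl' x (hx x hx')
      · exact Set.disjoint_left.2 fun x hx hx' => G.irrefl' x (hx x hx')
      · exact fun a ha b hb => ha b hb
      · exact fun a ha b hb => hb a ha
    obtain ⟨f, -, hf, hP, hQ⟩ := hN G hNB (fun _ => Set.univ) Set.univ Set.univ
      (fun _ _ => by omega) (by omega) (by omega)
    have hg : ∀ u v, H.adj u v →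
        G.adj (f ⟨u, Finset.mem_univ u⟩) (f ⟨v, Finset.mem_univ v⟩) :=
      fun u v h => hf ⟨u, Finset.mem_univ u⟩ ⟨v, Finset.mem_univ v⟩ h
    have hinj : Function.Injective fun u => f ⟨u, Finset.mem_univ u⟩ := by
      intro u v huv
      by_contra hne
      have huv' : f ⟨u, Finset.mem_univ u⟩ = f ⟨v, Finset.mem_univ v⟩ := huv
      rcases H.total u v hne with h | h
      · have := hg _ _ h
        rw [huv'] at this
        exact G.irrefl' _ this
      · have := hg _ _ h
        rw [huv'] at this
        exact G.irrefl' _ this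
    have hsub : (Set.range fun u => f ⟨u, Finset.mem_univ u⟩) ⊆ Set.range f := by
      rintro _ ⟨u, rfl⟩
      exact ⟨_, rfl⟩
    refine hNB (fun u => f ⟨u, Finset.mem_univ u⟩) hinj ?_ ?_ ?_
    · intro u v
      refine ⟨hg u v, fun h => ?_⟩
      by_contra hn
      rcases eq_or_ne u v with rfl | hne
      · exact G.irrefl' _ h
      · rcases H.total u v hne with h' | h'
        · exact hn h'
        · exact G.asymm _ _ h (hg _ _ h')
    · refine (hP.trans (Tournament.mu_le_chi hH G _)).trans (Tournament.chiOn_mono G ?_)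
      exact fun x hx a ha => hx.1 a (hsub ha)
    · refine (hQ.trans (Tournament.mu_le_chi hH G _)).trans (Tournament.chiOn_mono G ?_)
      exact fun x hx a ha => hx.1 a (hsub ha)
end

section
/- Let H1 and H2 be heroes, and let H be the tournament obtained from the disjoint union of H1 and H2 by directing every edge between them from V(H1) to V(H2). Then H is a hero. -/
namespace Tournament

/-- The one-vertex tournament. -/
def oneT : Tournament where
  V := PUnit
  fintype := inferInstance
  adj _ _ := False
  asymm := by intro u v h; exact h.elim
  total := by intro u v h; cases u; cases v; exact absurd rfl h

/-- `Δ(H1,H2,H3)`: disjoint copies of `H1,H2,H3` with `A1 ⇒ A2 ⇒ A3 ⇒ A1`. -/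
def delta (H1 H2 H3 : Tournament) : Tournament where
  V := H1.V ⊕ H2.V ⊕ H3.V
  fintype := inferInstance
  adj x y :=
    match x, y with
    | .inl a, .inl b => H1.adj a b
    | .inl _, .inr (.inl _) => True
    | .inl _, .inr (.inr _) => False
    | .inr (.inl _), .inl _ => False
    | .inr (.inl a), .inr (.inl b) => H2.adj a b
    | .inr (.inl _), .inr (.inr _) => True
    | .inr (.inr _), .inl _ => True
    | .inr (.inr _), .inr (.inl _) => False
    | .inr (.inr a), .inr (.inr b) => H3.adj a b
  asymm := by
    rintro (a | a | a) (b | b | b) h <;> simp only at h ⊢ <;>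
      first
        | exact H1.asymm _ _ h
        | exact H2.asymm _ _ h
        | exact H3.asymm _ _ h
        | exact h
        | exact fun h' => h'
  total := by
    rintro (a | a | a) (b | b | b) h <;> simp only at h ⊢ <;>
      first
        | exact H1.total _ _ (by simpa using h)
        | exact H2.total _ _ (by simpa using h)
        | exact H3.total _ _ (by simpa using h)
        | exact Or.inl trivial
        | exact Or.inr trivial

/-- The tournament obtained from disjoint copies of `H1, H2` by directing
all edges from the copy of `H1` to the copy of `H2`. -/
def join2 (H1 H2 : Tournament) : Tournament where
  V := H1.V ⊕ H2.V
  fintype := inferInstance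
  adj x y :=
    match x, y with
    | .inl a, .inl b => H1.adj a b
    | .inl _, .inr _ => True
    | .inr _, .inl _ => False
    | .inr a, .inr b => H2.adj a b
  asymm := by
    rintro (a | a) (b | b) h <;> simp only at h ⊢ <;>
      first
        | exact H1.asymm _ _ h
        | exact H2.asymm _ _ h
        | exact h
        | exact fun h' => h'
  total := by
    rintro (a | a) (b | b) h <;> simp only at h ⊢ <;>
      first
        | exact H1.total _ _ (by simpa using h)
        | exact H2.total _ _ (by simpa using h)
        | exact Or.inl trivial
        | exact Or.inr trivial

end Tournament


namespace Tournament

open Classical in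
/-- `A` can be covered by at most `k` transitive sets. -/
def Col (T : Tournament) (A : Set T.V) (k : ℕ) : Prop :=
  ∃ S : Finset (Set T.V), S.card ≤ k ∧ (∀ s ∈ S, T.IsTransitiveSet s) ∧ ∀ a ∈ A, ∃ s ∈ S, a ∈ s

theorem Col.mono {T : Tournament} {A B : Set T.V} {k l : ℕ} (h : T.Col B k)
    (hAB : A ⊆ B) (hkl : k ≤ l) : T.Col A l := by
  obtain ⟨S, h1, h2, h3⟩ := h
  exact ⟨S, h1.trans hkl, h2, fun a ha => h3 a (hAB ha)⟩

theorem Col.union {T : Tournament} {A B : Set T.V} {k l : ℕ} (h : T.Col A k)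
    (h' : T.Col B l) : T.Col (A ∪ B) (k + l) := by
  classical
  obtain ⟨S, h1, h2, h3⟩ := h
  obtain ⟨S', h1', h2', h3'⟩ := h'
  refine ⟨S ∪ S', (Finset.card_union_le _ _).trans (by omega), ?_, ?_⟩
  · intro s hs
    rcases Finset.mem_union.1 hs with hs | hs
    · exact h2 s hs
    · exact h2' s hs
  · rintro a (ha | ha)
    · obtain ⟨s, hs, has⟩ := h3 a ha
      exact ⟨s, Finset.mem_union_left _ hs, has⟩
    · obtain ⟨s, hs, has⟩ := h3' a ha
      exact ⟨s, Finset.mem_union_right _ hs, has⟩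

theorem Col.empty (T : Tournament) (k : ℕ) : T.Col ∅ k :=
  ⟨∅, by simp, by simp, by simp⟩

theorem Col.singleton (T : Tournament) (v : T.V) : T.Col {v} 1 := by
  refine ⟨{{v}}, by simp, ?_, by simp⟩
  intro s hs
  rw [Finset.mem_singleton] at hs
  subst hs
  rintro a rfl b hb c hc h
  rw [Set.mem_singleton_iff] at hb
  subst hb
  exact absurd h (T.asymm _ _ h)

theorem Col.biUnion {T : Tournament} {ι : Type*} (I : Finset ι) (F : ι → Set T.V) (k : ℕ)
    (h : ∀ i ∈ I, T.Col (F i) k) : T.Col {v | ∃ i ∈ I, v ∈ F i} (I.card * k) := by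
  classical
  induction I using Finset.induction_on with
  | empty => exact (Col.empty T _).mono (by intro v hv; simp at hv) le_rfl
  | insert i I hi ih =>
    have h1 := ih (fun j hj => h j (Finset.mem_insert_of_mem hj))
    have h2 := h i (Finset.mem_insert_self _ _)
    refine (h1.union h2).mono ?_ ?_
    · rintro v ⟨j, hj, hv⟩
      rcases Finset.mem_insert.1 hj with rfl | hj
      · exact Or.inr hv
      · exact Or.inl ⟨j, hj, hv⟩
    · rw [Finset.card_insert_of_notMem hi]; ring_nf; rfl

theorem Col.finset {T : Tournament} (X : Finset T.V) : T.Col (↑X) X.card := by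
  refine (Col.biUnion X (fun v => {v}) 1 (fun v _ => Col.singleton T v)).mono ?_ (by simp)
  intro v hv
  exact ⟨v, hv, rfl⟩

theorem Col.chi_le {T : Tournament} {k : ℕ} (h : T.Col Set.univ k) : T.chi ≤ k := by
  obtain ⟨S, h1, h2, h3⟩ := h
  refine le_trans (Nat.sInf_le ⟨fun i => (S.equivFin.symm i).1, ?_, ?_⟩) h1
  · intro i
    exact h2 _ (S.equivFin.symm i).2
  · intro a ha
    obtain ⟨s, hs, has⟩ := h3 a ha
    refine Set.mem_iUnion.2 ⟨S.equivFin ⟨s, hs⟩, ?_⟩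
    simpa using has

theorem col_chi (T : Tournament) : T.Col Set.univ T.chi := by
  classical
  have hne : {k | ∃ C : Fin k → Set T.V, (∀ i, T.IsTransitiveSet (C i)) ∧
      Set.univ ⊆ ⋃ i, C i}.Nonempty := by
    refine ⟨Fintype.card T.V, fun i => {(Fintype.equivFin T.V).symm i}, ?_, ?_⟩
    · intro i a ha b hb c hc h
      rw [Set.mem_singleton_iff] at ha hb
      subst ha
      subst hb
      exact absurd h (T.asymm _ _ h)
    · intro v _
      exact Set.mem_iUnion.2 ⟨Fintype.equivFin T.V v, by simp⟩
  obtain ⟨C, h1, h2⟩ := Nat.sInf_mem hne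
  refine ⟨Finset.univ.image C, ?_, ?_, ?_⟩
  · refine Finset.card_image_le.trans ?_
    rw [Finset.card_univ, Fintype.card_fin]
    exact le_rfl
  · intro s hs
    obtain ⟨i, _, rfl⟩ := Finset.mem_image.1 hs
    exact h1 i
  · intro a ha
    obtain ⟨i, hi⟩ := Set.mem_iUnion.1 (h2 ha)
    exact ⟨C i, Finset.mem_image_of_mem _ (Finset.mem_univ _), hi⟩

/-- Induced subtournament. -/
noncomputable def sub (T : Tournament) (A : Set T.V) : Tournament where
  V := A
  fintype := Fintype.ofFinite A
  adj u v := T.adj u.1 v.1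
  asymm u v := T.asymm _ _
  total u v h := T.total _ _ (fun h' => h (Subtype.ext h'))

theorem contains_of_not_col {H : Tournament} {c : ℕ}
    (hc : ∀ G : Tournament, ¬ G.Contains H → G.chi < c) (G : Tournament) (A : Set G.V)
    (hA : ¬ G.Col A c) : G.ContainsOn A H := by
  classical
  by_contra hcon
  apply hA
  have h1 : (G.sub A).chi < c := by
    apply hc
    rintro ⟨f, hf, _, hadj⟩
    exact hcon ⟨fun u => (f u).1, fun u v h => hf (Subtype.ext h), fun u => (f u).2, hadj⟩
  obtain ⟨S, hS1, hS2, hS3⟩ := col_chi (G.sub A)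
  refine ⟨S.image (fun s => {v | ∃ h : v ∈ A, (⟨v, h⟩ : A) ∈ s}),
    Finset.card_image_le.trans (by omega), ?_, ?_⟩
  · intro t ht
    obtain ⟨s, hs, rfl⟩ := Finset.mem_image.1 ht
    rintro a ⟨ha, ha'⟩ b ⟨hb, hb'⟩ d ⟨hd, hd'⟩
    exact hS2 s hs _ ha' _ hb' _ hd'
  · intro a ha
    obtain ⟨s, hs, has⟩ := hS3 ⟨a, ha⟩ trivial
    exact ⟨_, Finset.mem_image_of_mem _ hs, ha, has⟩

/-- The consequence of being `H`-free used in the argument. -/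
structure Good (G : Tournament) (c n : ℕ) : Prop where
  out : ∀ A, ¬ G.Col A c → ∃ X : Finset G.V, ↑X ⊆ A ∧ X.card ≤ n ∧
    G.Col {b | ∀ a ∈ X, G.adj a b} c
  inn : ∀ A, ¬ G.Col A c → ∃ X : Finset G.V, ↑X ⊆ A ∧ X.card ≤ n ∧
    G.Col {b | ∀ a ∈ X, G.adj b a} c

theorem join_contains {G H1 H2 : Tournament} (f : H1.V → G.V) (g : H2.V → G.V)
    (hf : Function.Injective f) (hg : Function.Injective g)
    (hf' : ∀ u v, H1.adj u v ↔ G.adj (f u) (f v))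
    (hg' : ∀ u v, H2.adj u v ↔ G.adj (g u) (g v))
    (hfg : ∀ u v, G.adj (f u) (g v)) : G.Contains (H1.join2 H2) := by
  have hirr : ∀ v, ¬ G.adj v v := fun v h => G.asymm _ _ h h
  refine ⟨Sum.elim f g, ?_, fun _ => trivial, ?_⟩
  · rintro (u | u) (v | v) h
    · exact congrArg _ (hf h)
    · have h1 : f u = g v := h
      have := hfg u v
      rw [h1] at this
      exact absurd this (hirr _)
    · have h1 : g u = f v := h
      have := hfg v u
      rw [h1] at this
      exact absurd this (hirr _)
    · exact congrArg _ (hg h)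
  · rintro (u | u) (v | v)
    · exact hf' u v
    · exact ⟨fun _ => hfg u v, fun _ => trivial⟩
    · exact ⟨fun h => h.elim, fun h => G.asymm _ _ h (hfg v u)⟩
    · exact hg' u v

theorem good_of_free {H1 H2 : Tournament} {c1 c2 : ℕ}
    (h1 : ∀ G : Tournament, ¬ G.Contains H1 → G.chi < c1)
    (h2 : ∀ G : Tournament, ¬ G.Contains H2 → G.chi < c2)
    (G : Tournament) (hG : ¬ G.Contains (H1.join2 H2)) :
    G.Good (c1 + c2) (Fintype.card H1.V + Fintype.card H2.V) := by
  classical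
  constructor
  · intro A hA
    obtain ⟨f, hf, hfA, hf'⟩ := contains_of_not_col h1 G A
      (fun h => hA (h.mono subset_rfl (by omega)))
    refine ⟨Finset.univ.image f, ?_, ?_, ?_⟩
    · intro x hx
      obtain ⟨u, _, rfl⟩ := Finset.mem_image.1 (Finset.mem_coe.1 hx)
      exact hfA u
    · exact Finset.card_image_le.trans (by rw [Finset.card_univ]; omega)
    · by_contra hcon
      obtain ⟨g, hg, hgA, hg'⟩ := contains_of_not_col h2 G _
        (fun h => hcon (h.mono subset_rfl (by omega)))
      exact hG (join_contains f g hf hg hf' hg'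
        (fun u v => hgA v _ (Finset.mem_image_of_mem _ (Finset.mem_univ _))))
  · intro A hA
    obtain ⟨f, hf, hfA, hf'⟩ := contains_of_not_col h2 G A
      (fun h => hA (h.mono subset_rfl (by omega)))
    refine ⟨Finset.univ.image f, ?_, ?_, ?_⟩
    · intro x hx
      obtain ⟨u, _, rfl⟩ := Finset.mem_image.1 (Finset.mem_coe.1 hx)
      exact hfA u
    · exact Finset.card_image_le.trans (by rw [Finset.card_univ]; omega)
    · by_contra hcon
      obtain ⟨g, hg, hgA, hg'⟩ := contains_of_not_col h1 G _
        (fun h => hcon (h.mono subset_rfl (by omega)))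
      exact hG (join_contains g f hg hf hg' hf'
        (fun u v => hgA u _ (Finset.mem_image_of_mem _ (Finset.mem_univ _))))

/-- Vertices of `A` forming a cyclic triangle with the edge `uv`. -/
def cyc (G : Tournament) (A : Set G.V) (u v : G.V) : Set G.V :=
  {w | w ∈ A ∧ G.adj v w ∧ G.adj w u}

/-- Light in-neighbours. -/
def lightIn (G : Tournament) (A : Set G.V) (d : ℕ) (v : G.V) : Set G.V :=
  {a | a ∈ A ∧ G.adj a v ∧ G.Col (G.cyc A a v) d}

/-- Light out-neighbours. -/
def lightOut (G : Tournament) (A : Set G.V) (d : ℕ) (v : G.V) : Set G.V :=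
  {b | b ∈ A ∧ G.adj v b ∧ G.Col (G.cyc A v b) d}

theorem Good.lightIn {G : Tournament} {c n : ℕ} (hG : G.Good c n) (A : Set G.V) (d : ℕ)
    (v : G.V) (h : ¬ G.Col (G.lightIn A d v) c) :
    G.Col {b | b ∈ A ∧ G.adj v b} (n * d + c) := by
  obtain ⟨X, hX, hn, hcol⟩ := hG.out _ h
  have h1 := Col.biUnion X (fun a => G.cyc A a v) d (fun a ha => (hX ha).2.2)
  refine (h1.union hcol).mono ?_ (Nat.add_le_add_right (Nat.mul_le_mul_right _ hn) _)
  rintro b ⟨hbA, hb⟩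
  by_cases hb' : ∀ a ∈ X, G.adj a b
  · exact Or.inr hb'
  · push Not at hb'
    obtain ⟨a, ha, hab⟩ := hb'
    have hav : G.adj a v := (hX ha).2.1
    have hne : a ≠ b := by
      rintro rfl
      exact G.asymm _ _ hb hav
    exact Or.inl ⟨a, ha, hbA, hb, (G.total a b hne).resolve_left hab⟩

theorem Good.lightOut {G : Tournament} {c n : ℕ} (hG : G.Good c n) (A : Set G.V) (d : ℕ)
    (v : G.V) (h : ¬ G.Col (G.lightOut A d v) c) :
    G.Col {b | b ∈ A ∧ G.adj b v} (n * d + c) := by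
  obtain ⟨X, hX, hn, hcol⟩ := hG.inn _ h
  have h1 := Col.biUnion X (fun a => G.cyc A v a) d (fun a ha => (hX ha).2.2)
  refine (h1.union hcol).mono ?_ (Nat.add_le_add_right (Nat.mul_le_mul_right _ hn) _)
  rintro b ⟨hbA, hb⟩
  by_cases hb' : ∀ a ∈ X, G.adj b a
  · exact Or.inr hb'
  · push Not at hb'
    obtain ⟨a, ha, hab⟩ := hb'
    have hav : G.adj v a := (hX ha).2.1
    have hne : a ≠ b := by
      rintro rfl
      exact G.asymm _ _ hb hav
    exact Or.inl ⟨a, ha, hbA, (G.total a b hne).resolve_right hab, hb⟩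

theorem Good.smallOut {G : Tournament} {c n : ℕ} (hG : G.Good c n) (A : Set G.V) (k : ℕ)
    (h : ¬ G.Col {v | v ∈ A ∧ G.Col {b | b ∈ A ∧ G.adj v b} k} c) :
    G.Col A (n * k + c + n) := by
  obtain ⟨X, hX, hn, hcol⟩ := hG.inn _ h
  have h1 := Col.biUnion X (fun v => {b | b ∈ A ∧ G.adj v b}) k (fun a ha => (hX ha).2)
  refine ((h1.union hcol).union (Col.finset X)).mono ?_
    (Nat.add_le_add (Nat.add_le_add_right (Nat.mul_le_mul_right _ hn) _) hn)
  intro b hbA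
  by_cases hbX : b ∈ X
  · exact Or.inr hbX
  left
  by_cases hb' : ∀ a ∈ X, G.adj b a
  · exact Or.inr hb'
  · push Not at hb'
    obtain ⟨a, ha, hab⟩ := hb'
    have hne : a ≠ b := by
      rintro rfl
      exact hbX ha
    exact Or.inl ⟨a, ha, hbA, (G.total a b hne).resolve_right hab⟩

theorem Good.smallIn {G : Tournament} {c n : ℕ} (hG : G.Good c n) (A : Set G.V) (k : ℕ)
    (h : ¬ G.Col {v | v ∈ A ∧ G.Col {b | b ∈ A ∧ G.adj b v} k} c) :
    G.Col A (n * k + c + n) := by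
  obtain ⟨X, hX, hn, hcol⟩ := hG.out _ h
  have h1 := Col.biUnion X (fun v => {b | b ∈ A ∧ G.adj b v}) k (fun a ha => (hX ha).2)
  refine ((h1.union hcol).union (Col.finset X)).mono ?_
    (Nat.add_le_add (Nat.add_le_add_right (Nat.mul_le_mul_right _ hn) _) hn)
  intro b hbA
  by_cases hbX : b ∈ X
  · exact Or.inr hbX
  left
  by_cases hb' : ∀ a ∈ X, G.adj a b
  · exact Or.inr hb'
  · push Not at hb'
    obtain ⟨a, ha, hab⟩ := hb'
    have hne : a ≠ b := by
      rintro rfl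
      exact hbX ha
    exact Or.inl ⟨a, ha, hbA, (G.total a b hne).resolve_left hab⟩

/-- A large clique of heavy edges. -/
theorem Good.heavyClique {G : Tournament} {c n : ℕ} (hG : G.Good c n) (A : Set G.V) (d r : ℕ)
    (hA : ¬ G.Col A (n * (n * d + c) + c + n + (c + c) + r * (c + c + 1))) :
    ∃ X : Finset G.V, ↑X ⊆ A ∧ X.card = r ∧
      ∀ u ∈ X, ∀ v ∈ X, G.adj u v → ¬ G.Col (G.cyc A u v) d := by
  classical
  have hQ : G.Col {v | v ∈ A ∧ G.Col {b | b ∈ A ∧ G.adj v b} (n * d + c)} c := by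
    by_contra h
    exact hA ((hG.smallOut A _ h).mono subset_rfl (by omega))
  have hP : G.Col {v | v ∈ A ∧ G.Col {b | b ∈ A ∧ G.adj b v} (n * d + c)} c := by
    by_contra h
    exact hA ((hG.smallIn A _ h).mono subset_rfl (by omega))
  set Q := {v | v ∈ A ∧ G.Col {b | b ∈ A ∧ G.adj v b} (n * d + c)} with hQdef
  set P := {v | v ∈ A ∧ G.Col {b | b ∈ A ∧ G.adj b v} (n * d + c)} with hPdef
  have key : ∀ i ≤ r, ∃ X : Finset G.V, (∀ x ∈ X, x ∈ A ∧ x ∉ P ∧ x ∉ Q) ∧ X.card = i ∧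
      ∀ u ∈ X, ∀ v ∈ X, G.adj u v → ¬ G.Col (G.cyc A u v) d := by
    intro i
    induction i with
    | zero => intro _; exact ⟨∅, by simp, by simp, by simp⟩
    | succ i ih =>
      intro hi
      obtain ⟨X, hX1, hX2, hX3⟩ := ih (by omega)
      have hcol : ∀ x ∈ X, G.Col (G.lightIn A d x ∪ G.lightOut A d x ∪ {x}) (c + c + 1) := by
        intro x hx
        obtain ⟨hxA, hxP, hxQ⟩ := hX1 x hx
        refine Col.union (Col.union ?_ ?_) (Col.singleton G x)
        · by_contra h
          exact hxQ ⟨hxA, hG.lightIn A d x h⟩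
        · by_contra h
          exact hxP ⟨hxA, hG.lightOut A d x h⟩
      have hbig := (hP.union hQ).union (Col.biUnion X _ _ hcol)
      have hex : ∃ y ∈ A, y ∉ (P ∪ Q) ∪
          {v | ∃ x ∈ X, v ∈ G.lightIn A d x ∪ G.lightOut A d x ∪ {x}} := by
        by_contra hcon
        push Not at hcon
        apply hA
        refine hbig.mono hcon ?_
        rw [hX2]
        have : i * (c + c + 1) ≤ r * (c + c + 1) := Nat.mul_le_mul_right _ (by omega)
        omega
      obtain ⟨y, hyA, hy⟩ := hex
      have hyP : y ∉ P := fun h => hy (Or.inl (Or.inl h))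
      have hyQ : y ∉ Q := fun h => hy (Or.inl (Or.inr h))
      have hyX : y ∉ X := fun h => hy (Or.inr ⟨y, h, Or.inr rfl⟩)
      refine ⟨insert y X, ?_, ?_, ?_⟩
      · intro x hx
        rcases Finset.mem_insert.1 hx with rfl | hx
        · exact ⟨hyA, hyP, hyQ⟩
        · exact hX1 x hx
      · rw [Finset.card_insert_of_notMem hyX, hX2]
      · intro u hu v hv huv hc
        rcases Finset.mem_insert.1 hu with rfl | hu2
        · rcases Finset.mem_insert.1 hv with rfl | hv2
          · exact G.asymm _ _ huv huv
          · exact hy (Or.inr ⟨v, hv2, Or.inl (Or.inl ⟨hyA, huv, hc⟩)⟩)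
        · rcases Finset.mem_insert.1 hv with rfl | hv2
          · exact hy (Or.inr ⟨u, hu2, Or.inl (Or.inr ⟨hyA, huv, hc⟩)⟩)
          · exact hX3 u hu2 v hv2 huv hc
  obtain ⟨X, h1, h2, h3⟩ := key r le_rfl
  exact ⟨X, fun x hx => (h1 x hx).1, h2, h3⟩

/-- Large chromatic number forces bounded-size subsets of chromatic number more than `r`. -/
theorem mountain (c n r : ℕ) : ∃ s d : ℕ, ∀ G : Tournament, G.Good c n → ∀ A : Set G.V,
    ¬ G.Col A d → ∃ M : Finset G.V, ↑M ⊆ A ∧ M.card ≤ s ∧ ¬ G.Col ↑M r := by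
  classical
  induction r with
  | zero =>
    refine ⟨1, 0, fun G _ A hA => ?_⟩
    have : A.Nonempty := by
      by_contra h
      rw [Set.not_nonempty_iff_eq_empty] at h
      exact hA (h ▸ Col.empty G 0)
    obtain ⟨a, ha⟩ := this
    refine ⟨{a}, by simpa using ha, by simp, ?_⟩
    rintro ⟨S, h1, _, h3⟩
    obtain ⟨s, hs, _⟩ := h3 a (by simp)
    simp at h1
    simp [h1] at hs
  | succ r ih =>
    obtain ⟨s, d, ih⟩ := ih
    refine ⟨(r + 2) + (r + 2) * (r + 2) * s,
      n * (n * d + c) + c + n + (c + c) + (r + 2) * (c + c + 1), fun G hG A hA => ?_⟩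
    obtain ⟨X, hXA, hXc, hX⟩ := hG.heavyClique A d (r + 2) hA
    have hM : ∀ p : G.V × G.V, ∃ M : Finset G.V, ↑M ⊆ A ∧ M.card ≤ s ∧
        (p.1 ∈ X → p.2 ∈ X → G.adj p.1 p.2 → ↑M ⊆ G.cyc A p.1 p.2 ∧ ¬ G.Col ↑M r) := by
      intro p
      by_cases hp : p.1 ∈ X ∧ p.2 ∈ X ∧ G.adj p.1 p.2
      · obtain ⟨M, hM1, hM2, hM3⟩ := ih G hG _ (hX _ hp.1 _ hp.2.1 hp.2.2)
        exact ⟨M, fun x hx => (hM1 hx).1, hM2, fun _ _ _ => ⟨hM1, hM3⟩⟩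
      · exact ⟨∅, by simp, by simp, fun a b c => absurd ⟨a, b, c⟩ hp⟩
    choose M hM1 hM2 hM3 using hM
    refine ⟨X ∪ (X ×ˢ X).biUnion M, ?_, ?_, ?_⟩
    · intro x hx
      rcases Finset.mem_union.1 (Finset.mem_coe.1 hx) with hx | hx
      · exact hXA hx
      · obtain ⟨p, _, hx⟩ := Finset.mem_biUnion.1 hx
        exact hM1 p hx
    · refine (Finset.card_union_le _ _).trans (Nat.add_le_add hXc.le ?_)
      refine (Finset.card_biUnion_le_card_mul _ _ s (fun p _ => hM2 p)).trans ?_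
      rw [Finset.card_product, hXc]
    · rintro ⟨S, hS1, hS2, hS3⟩
      have hX3 : ∀ x, ∃ t : Set G.V, x ∈ X → t ∈ S ∧ x ∈ t := by
        intro x
        by_cases hx : x ∈ X
        · obtain ⟨t, ht, hxt⟩ := hS3 x (Finset.mem_coe.2 (Finset.mem_union_left _ hx))
          exact ⟨t, fun _ => ⟨ht, hxt⟩⟩
        · exact ⟨∅, fun h => absurd h hx⟩
      choose f hf using hX3
      obtain ⟨u, hu, v, hv, huv, hfuv⟩ := Finset.exists_ne_map_eq_of_card_lt_of_maps_to
        (s := X) (t := S) (by omega) (f := f) (fun x hx => (hf x hx).1)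
      have main : ∀ u ∈ X, ∀ v ∈ X, f u = f v → G.adj u v → False := by
        intro u hu v hv hfuv huv
        obtain ⟨hcyc, hncol⟩ := hM3 (u, v) hu hv huv
        apply hncol
        refine ⟨S.erase (f u), ?_, ?_, ?_⟩
        · rw [Finset.card_erase_of_mem (hf u hu).1]; omega
        · intro t ht
          exact hS2 t (Finset.mem_of_mem_erase ht)
        · intro w hw
          obtain ⟨t, ht, hwt⟩ := hS3 w (Finset.mem_coe.2 (Finset.mem_union_right _
            (Finset.mem_biUnion.2 ⟨(u, v), Finset.mem_product.2 ⟨hu, hv⟩, hw⟩)))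
          refine ⟨t, Finset.mem_erase.2 ⟨?_, ht⟩, hwt⟩
          rintro rfl
          obtain ⟨_, hvw, hwu⟩ := hcyc hw
          exact hS2 _ ht u (hf u hu).2 v (hfuv ▸ (hf v hv).2) w hwt huv hvw hwu
      rcases G.total u v huv with h | h
      · exact main u hu v hv hfuv h
      · exact main v hv u hu hfuv.symm h

theorem Good.bounded (c n : ℕ) : ∃ k, ∀ G : Tournament, G.Good c n → G.Col Set.univ k := by
  classical
  obtain ⟨s, d, h⟩ := mountain c n (c + c)
  refine ⟨d + (s + 2 ^ s * c), fun G hG => ?_⟩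
  by_cases hd : G.Col Set.univ d
  · exact hd.mono subset_rfl (by omega)
  obtain ⟨M, _, hMs, hM⟩ := h G hG _ hd
  have h1 : ∀ S ∈ M.powerset, G.Col {z | z ∉ M ∧ ∀ m ∈ M, m ∈ S ↔ G.adj z m} c := by
    intro S hS
    rw [Finset.mem_powerset] at hS
    by_cases hSc : G.Col (↑S) c
    · have h2 : ¬ G.Col (↑(M \ S)) c := by
        intro h2
        refine hM ((hSc.union h2).mono ?_ le_rfl)
        intro x hx
        by_cases hxS : x ∈ S
        · exact Or.inl hxS
        · exact Or.inr (Finset.mem_coe.2 (Finset.mem_sdiff.2 ⟨hx, hxS⟩))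
      obtain ⟨X, hX, _, hcol⟩ := hG.out _ h2
      refine hcol.mono ?_ le_rfl
      rintro z ⟨hzM, hz⟩ a ha
      obtain ⟨haM, haS⟩ := Finset.mem_sdiff.1 (Finset.mem_coe.1 (hX ha))
      have hne : z ≠ a := by
        rintro rfl
        exact hzM haM
      exact (G.total z a hne).resolve_left (fun h => haS ((hz a haM).2 h))
    · obtain ⟨X, hX, _, hcol⟩ := hG.inn _ hSc
      refine hcol.mono ?_ le_rfl
      rintro z ⟨hzM, hz⟩ a ha
      exact (hz a (hS (hX ha))).1 (hX ha)
  refine ((Col.finset M).union (Col.biUnion M.powerset _ c h1)).mono ?_ ?_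
  · intro z _
    by_cases hz : z ∈ M
    · exact Or.inl hz
    · refine Or.inr ⟨M.filter (fun m => G.adj z m), by simp, hz, ?_⟩
      intro m hm
      simp [hm]
  · rw [Finset.card_powerset]
    have : 2 ^ M.card * c ≤ 2 ^ s * c :=
      Nat.mul_le_mul_right _ (Nat.pow_le_pow_right (by norm_num) hMs)
    omega

end Tournament

/-- If `H1, H2` are heroes, then the tournament obtained from their disjoint union
by directing all edges from `V(H1)` to `V(H2)` is a hero. -/
theorem join_of_heroes (H1 H2 : Tournament)
    (h1 : H1.IsHero) (h2 : H2.IsHero) :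
    (H1.join2 H2).IsHero := by
  obtain ⟨c1, _, h1⟩ := h1
  obtain ⟨c2, _, h2⟩ := h2
  obtain ⟨k, hk⟩ := Tournament.Good.bounded (c1 + c2) (Fintype.card H1.V + Fintype.card H2.V)
  refine ⟨k + 1, Nat.succ_pos _, fun G hG => ?_⟩
  exact Nat.lt_succ_of_le (hk G (Tournament.good_of_free h1 h2 G hG)).chi_le
end
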